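/- Fix 0 < R₁ < R₂. There exists a constant C > 0 such that for all δ ∈ (0, π/2): λ₂(B_{R₂}⁺) ≤ λ₂(B_{R₂}⁺ \ K_δ⁺) ≤ λ₂(B_{R₂}⁺) + C δ². (Equivalently, with ε = π/2 − δ, the lowest eigenvalue λ₁^{DDD} of the cracked quarter-disk with Dirichlet conditions on both radii satisfies λ₂(B_{R₂}⁺) ≤ λ₁^{DDD} ≤ λ₂(B_{R₂}⁺) + C(π/2 − ε)².) -/

import Mathlib

open MeasureTheory Real Set

noncomputable section

/-- A Dirichlet test function on `ω`: smooth, compactly supported, with support in `ω`. -/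
def testFun (ω : Set (ℝ × ℝ)) (u : (ℝ × ℝ) → ℝ) : Prop :=
  ContDiff ℝ (⊤ : ℕ∞) u ∧ HasCompactSupport u ∧ tsupport u ⊆ ω

/-- `|∇u|²` at a point. -/
def gradSq (u : (ℝ × ℝ) → ℝ) (x : ℝ × ℝ) : ℝ :=
  fderiv ℝ u x (1, 0) ^ 2 + fderiv ℝ u x (0, 1) ^ 2

/-- The Rayleigh quotient of `u` on `ω`. -/
def rayleigh (ω : Set (ℝ × ℝ)) (u : (ℝ × ℝ) → ℝ) : ℝ :=
  (∫ x in ω, gradSq u x) / ∫ x in ω, u x ^ 2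

/-- The `k`-th Dirichlet eigenvalue of `ω` (`k ≥ 1`), via the Courant–Fischer
min-max formula over `k`-dimensional subspaces of `C_c^∞(ω)`. -/
def dirichletEV (ω : Set (ℝ × ℝ)) (k : ℕ) : ℝ :=
  sInf {l | ∃ V : Submodule ℝ ((ℝ × ℝ) → ℝ),
    (V : Set ((ℝ × ℝ) → ℝ)) ⊆ {u | testFun ω u} ∧ Module.finrank ℝ V = k ∧
    l = sSup {r | ∃ u ∈ V, u ≠ 0 ∧ r = rayleigh ω u}}

/-- The open disk `B_R` centered at the origin. -/
def disk (R : ℝ) : Set (ℝ × ℝ) := {x | x.1 ^ 2 + x.2 ^ 2 < R ^ 2}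

/-- The open annulus `M_{R₁,R₂} = B_{R₂} \ closure (B_{R₁})`. -/
def annulus (R₁ R₂ : ℝ) : Set (ℝ × ℝ) := disk R₂ \ closure (disk R₁)

/-- `D_{R₁,R₂} = B_{R₁} ∪ M_{R₁,R₂}`. -/
def diskUnionAnnulus (R₁ R₂ : ℝ) : Set (ℝ × ℝ) := disk R₁ ∪ annulus R₁ R₂

/-- The cracked domain `𝔇(N,ε)`. -/
def crackedDomain (R₁ R₂ : ℝ) (N : ℕ) (ε : ℝ) : Set (ℝ × ℝ) :=
  diskUnionAnnulus R₁ R₂ ∪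
    ⋃ j ∈ Finset.range N, {x | ∃ θ : ℝ, θ ∈ Set.Ioo (2 * π * j / N - ε) (2 * π * j / N + ε) ∧
      x = (R₁ * Real.cos θ, R₁ * Real.sin θ)}

/-- The open upper half-disk `B_R⁺ = B_R ∩ {x₂ > 0}`. -/
def halfDisk (R : ℝ) : Set (ℝ × ℝ) := disk R ∩ {x | 0 < x.2}

/-- The compact set `K_δ`: two closed arcs of angular half-width `δ` on the circle of radius
`R₁`, centered at the points `(0, R₁)` and `(0, −R₁)`. -/
def crackSet (R₁ δ : ℝ) : Set (ℝ × ℝ) :=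
  {x | ∃ θ : ℝ, (θ ∈ Set.Icc (π / 2 - δ) (π / 2 + δ) ∨
      θ ∈ Set.Icc (-(π / 2) - δ) (-(π / 2) + δ)) ∧
    x = (R₁ * Real.cos θ, R₁ * Real.sin θ)}

/-- `K_δ⁺ = K_δ ∩ {x₂ > 0}`. -/
def crackSetPlus (R₁ δ : ℝ) : Set (ℝ × ℝ) := crackSet R₁ δ ∩ {x | 0 < x.2}

/-- The entire function `∑ (-s)^j / (j! (j+m)!)`, for which
`J_m(x) = (x/2)^m besselSeries m (x²/4)`. -/
def besselSeries (m : ℕ) (s : ℝ) : ℝ :=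
  ∑' j : ℕ, (-s) ^ j / (j.factorial * (j + m).factorial)

theorem abs_besselSeries_term_le (m j : ℕ) (s : ℝ) :
    ‖(-s) ^ j / (j.factorial * (j + m).factorial : ℝ)‖ ≤ |s| ^ j / j.factorial := by
  rw [norm_div, norm_pow, norm_neg, Real.norm_eq_abs]
  have h1 : (1 : ℝ) ≤ ((j + m).factorial : ℝ) := by exact_mod_cast Nat.factorial_pos _
  have h2 : (0 : ℝ) < (j.factorial : ℝ) := by exact_mod_cast Nat.factorial_pos _
  rw [Real.norm_of_nonneg (by positivity)]
  gcongr
  nlinarith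

theorem summable_besselSeries (m : ℕ) (s : ℝ) :
    Summable fun j : ℕ => (-s) ^ j / (j.factorial * (j + m).factorial : ℝ) :=
  Summable.of_norm_bounded (Real.summable_pow_div_factorial |s|)
    fun j => abs_besselSeries_term_le m j s

theorem hasDerivAt_besselSeries (m : ℕ) (s : ℝ) :
    HasDerivAt (besselSeries m) (-besselSeries (m + 1) s) s := by
  have hterm : ∀ (n : ℕ) (y : ℝ), HasDerivAt
      (fun z : ℝ => (-z) ^ n / (n.factorial * (n + m).factorial : ℝ))
      ((n : ℝ) * (-y) ^ (n - 1) * (-1) / (n.factorial * (n + m).factorial : ℝ)) y := by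
    intro n y
    exact ((hasDerivAt_neg y).pow n).div_const _
  have hshift : ∀ (n : ℕ) (y : ℝ),
      ((n + 1 : ℕ) : ℝ) * (-y) ^ (n + 1 - 1) * (-1) /
        ((n + 1).factorial * (n + 1 + m).factorial : ℝ) =
      -((-y) ^ n / (n.factorial * (n + (m + 1)).factorial : ℝ)) := by
    intro n y
    have h2 : (n.factorial : ℝ) ≠ 0 := by exact_mod_cast Nat.factorial_ne_zero _
    have h3 : ((n + (m + 1)).factorial : ℝ) ≠ 0 := by exact_mod_cast Nat.factorial_ne_zero _
    have h4 : n + 1 + m = n + (m + 1) := by ring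
    rw [h4, Nat.factorial_succ]
    push_cast
    have h5 : (n : ℝ) + 1 ≠ 0 := by positivity
    field_simp
  have hu : Summable fun n : ℕ => match n with
      | 0 => (0 : ℝ)
      | k + 1 => (|s| + 1) ^ k / k.factorial :=
    (summable_nat_add_iff 1).1 (Real.summable_pow_div_factorial (|s| + 1))
  have key := hasDerivAt_tsum_of_isPreconnected (g := fun (n : ℕ) (z : ℝ) =>
      (-z) ^ n / (n.factorial * (n + m).factorial : ℝ))
    (g' := fun n y => (n : ℝ) * (-y) ^ (n - 1) * (-1) / (n.factorial * (n + m).factorial : ℝ))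
    (t := Metric.ball s 1) (y₀ := s) (y := s) hu Metric.isOpen_ball
    (convex_ball s 1).isPreconnected (fun n y _ => hterm n y)
    (fun n y hy => by
      rcases n with _ | n
      · simp
      · simp only [hshift, norm_neg]
        refine (abs_besselSeries_term_le (m + 1) n y).trans ?_
        have : |y| ≤ |s| + 1 := by
          rw [Metric.mem_ball, Real.dist_eq] at hy
          have := abs_sub_abs_le_abs_sub y s
          linarith
        gcongr)
    (Metric.mem_ball_self one_pos) (summable_besselSeries m s) (Metric.mem_ball_self one_pos)
  have hsum : (∑' n : ℕ, (n : ℝ) * (-s) ^ (n - 1) * (-1) /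
      (n.factorial * (n + m).factorial : ℝ)) = -besselSeries (m + 1) s := by
    rw [tsum_eq_zero_add']
    · simp only [hshift]
      simp [besselSeries, tsum_neg]
    · simp only [hshift]
      exact (summable_besselSeries (m + 1) s).neg
  rw [hsum] at key
  exact key

theorem besselSeries_recurrence (m : ℕ) (s : ℝ) :
    s * besselSeries (m + 2) s - (m + 1) * besselSeries (m + 1) s + besselSeries m s = 0 := by
  have h1 : s * besselSeries (m + 2) s =
      -∑' j : ℕ, (j : ℝ) * ((-s) ^ j / (j.factorial * (j + (m + 1)).factorial : ℝ)) := by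
    have hs : ∀ j : ℕ, ((j + 1 : ℕ) : ℝ) * ((-s) ^ (j + 1) /
        ((j + 1).factorial * (j + 1 + (m + 1)).factorial : ℝ)) =
        -s * ((-s) ^ j / (j.factorial * (j + (m + 2)).factorial : ℝ)) := by
      intro j
      have h2 : (j.factorial : ℝ) ≠ 0 := by exact_mod_cast Nat.factorial_ne_zero _
      have h3 : ((j + (m + 2)).factorial : ℝ) ≠ 0 := by exact_mod_cast Nat.factorial_ne_zero _
      have h4 : j + 1 + (m + 1) = j + (m + 2) := by ring
      rw [h4, Nat.factorial_succ]
      push_cast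
      have h5 : (j : ℝ) + 1 ≠ 0 := by positivity
      field_simp
      ring
    rw [tsum_eq_zero_add']
    · simp only [hs]
      rw [tsum_mul_left]
      simp [besselSeries]
    · simp only [hs]
      exact (summable_besselSeries (m + 2) s).mul_left _
  have hsum : Summable fun j : ℕ =>
      (j : ℝ) * ((-s) ^ j / (j.factorial * (j + (m + 1)).factorial : ℝ)) := by
    have : (fun j : ℕ => (j : ℝ) * ((-s) ^ j / (j.factorial * (j + (m + 1)).factorial : ℝ))) =
        fun j => (-s) ^ j / (j.factorial * (j + m).factorial : ℝ) -
          (m + 1) * ((-s) ^ j / (j.factorial * (j + (m + 1)).factorial : ℝ)) := by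
      funext j
      have h2 : (j.factorial : ℝ) ≠ 0 := by exact_mod_cast Nat.factorial_ne_zero _
      have h3 : ((j + m).factorial : ℝ) ≠ 0 := by exact_mod_cast Nat.factorial_ne_zero _
      rw [show j + (m + 1) = (j + m) + 1 by ring, Nat.factorial_succ]
      push_cast
      have h5 : (j : ℝ) + m + 1 ≠ 0 := by positivity
      field_simp
      ring
    rw [this]
    exact (summable_besselSeries m s).sub ((summable_besselSeries (m + 1) s).mul_left _)
  rw [h1]
  simp only [besselSeries]
  rw [← tsum_mul_left, ← tsum_neg, ← Summable.tsum_sub hsum.neg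
    ((summable_besselSeries (m + 1) s).mul_left _), ← Summable.tsum_add
    (hsum.neg.sub ((summable_besselSeries (m + 1) s).mul_left _)) (summable_besselSeries m s)]
  convert tsum_zero with j
  have h2 : (j.factorial : ℝ) ≠ 0 := by exact_mod_cast Nat.factorial_ne_zero _
  have h3 : ((j + m).factorial : ℝ) ≠ 0 := by exact_mod_cast Nat.factorial_ne_zero _
  rw [show j + (m + 1) = (j + m) + 1 by ring, Nat.factorial_succ]
  push_cast
  have h5 : (j : ℝ) + m + 1 ≠ 0 := by positivity
  field_simp
  ring

theorem contDiff_besselSeries (m : ℕ) : ContDiff ℝ (⊤ : ℕ∞) (besselSeries m) := by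
  have hd : ∀ m, deriv (besselSeries m) = fun s => -besselSeries (m + 1) s :=
    fun m => funext fun s => (hasDerivAt_besselSeries m s).deriv
  have key : ∀ n m : ℕ, ContDiff ℝ n (besselSeries m) := by
    intro n
    induction n with
    | zero =>
      intro m
      exact contDiff_zero.2 (continuous_iff_continuousAt.2
        fun s => (hasDerivAt_besselSeries m s).continuousAt)
    | succ n ih =>
      intro m
      rw [Nat.cast_add, Nat.cast_one, contDiff_succ_iff_deriv]
      refine ⟨fun s => (hasDerivAt_besselSeries m s).differentiableAt, ?_, ?_⟩
      · intro h
        exact absurd h (by simp)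
      · rw [hd]
        exact (ih (m + 1)).neg
  exact contDiff_infty.2 fun n => key n m

theorem continuous_besselSeries (m : ℕ) : Continuous (besselSeries m) :=
  (contDiff_besselSeries m).continuous

theorem besselSeries_two_zero : besselSeries 2 0 = 1 / 2 := by
  rw [besselSeries, tsum_eq_single 0]
  · norm_num [Nat.factorial]
  · intro j hj
    simp [hj]

theorem besselSeries_two_eight_neg : besselSeries 2 8 < 0 := by
  have hsm := summable_besselSeries 2 8
  set f : ℕ → ℝ := fun i => (8 : ℝ) ^ (i + 2) / ((i + 2).factorial * (i + 4).factorial) with hf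
  have hterm : ∀ i : ℕ, (-8 : ℝ) ^ (i + 2) / ((i + 2).factorial * (i + 2 + 2).factorial : ℝ) =
      (-1) ^ i * f i := by
    intro i
    rw [hf, show (-8 : ℝ) = (-1) * 8 by norm_num, mul_pow, pow_add (-1 : ℝ) i 2]
    ring
  have hs2 : Summable fun i : ℕ => (-1) ^ i * f i := by
    have := (summable_nat_add_iff 2).2 hsm
    simpa only [hterm] using this
  have hanti : Antitone f := by
    refine antitone_nat_of_succ_le fun n => ?_
    simp only [hf]
    rw [show n + 1 + 4 = (n + 4) + 1 by ring, show n + 1 + 2 = (n + 2) + 1 by ring,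
      Nat.factorial_succ, Nat.factorial_succ (n + 4)]
    push_cast
    have h2 : (0 : ℝ) < ((n + 2).factorial : ℝ) := by exact_mod_cast Nat.factorial_pos _
    have h3 : (0 : ℝ) < ((n + 4).factorial : ℝ) := by exact_mod_cast Nat.factorial_pos _
    rw [div_le_div_iff₀ (by positivity) (by positivity), pow_succ (8 : ℝ) (n + 2)]
    have h8 : (0 : ℝ) < 8 ^ (n + 2) := by positivity
    have : (8 : ℝ) ≤ ((n : ℝ) + 2 + 1) * ((n : ℝ) + 4 + 1) := by nlinarith [Nat.cast_nonneg (α := ℝ) n]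
    calc (8 : ℝ) ^ (n + 2) * 8 * ((n + 2).factorial * (n + 4).factorial)
        = (8 ^ (n + 2) * ((n + 2).factorial * (n + 4).factorial)) * 8 := by ring
      _ ≤ (8 ^ (n + 2) * ((n + 2).factorial * (n + 4).factorial)) *
          (((n : ℝ) + 2 + 1) * ((n : ℝ) + 4 + 1)) := by gcongr
      _ = _ := by ring
  have hb := hanti.tendsto_le_alternating_series hs2.hasSum.tendsto_sum_nat 2
  have hsplit := hsm.sum_add_tsum_nat_add 2
  simp only [hterm] at hsplit
  rw [besselSeries, ← hsplit]
  norm_num [Finset.sum_range_succ, hf, Nat.factorial] at hb ⊢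
  linarith

/-- The first positive zero of `besselSeries 2`. -/
theorem exists_first_zero_besselSeries_two :
    ∃ s₀ : ℝ, 0 < s₀ ∧ besselSeries 2 s₀ = 0 ∧ ∀ s ∈ Ico 0 s₀, 0 < besselSeries 2 s := by
  have hK : IsCompact (Icc (0 : ℝ) 8 ∩ {s | besselSeries 2 s ≤ 0}) :=
    isCompact_Icc.inter_right (isClosed_le (continuous_besselSeries 2) continuous_const)
  obtain ⟨s₀, ⟨⟨h0, h8⟩, hle⟩, hmin⟩ := hK.exists_isLeast
    ⟨8, ⟨by norm_num, le_rfl⟩, besselSeries_two_eight_neg.le⟩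
  have hpos : ∀ s ∈ Ico 0 s₀, 0 < besselSeries 2 s := by
    intro s hs
    by_contra h
    have := hmin ⟨⟨hs.1, hs.2.le.trans h8⟩, not_lt.1 h⟩
    exact absurd this (not_le.2 hs.2)
  have hne : s₀ ≠ 0 := by
    rintro rfl
    have : besselSeries 2 0 ≤ 0 := hle
    rw [besselSeries_two_zero] at this
    norm_num at this
  have h0' : 0 < s₀ := lt_of_le_of_ne h0 hne.symm
  refine ⟨s₀, h0', le_antisymm hle ?_, hpos⟩
  have hcl : s₀ ∈ closure (Ico 0 s₀) := by
    rw [closure_Ico hne.symm]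
    exact ⟨h0, le_rfl⟩
  exact closure_minimal (fun s hs => (hpos s hs).le)
    (isClosed_le continuous_const (continuous_besselSeries 2)) hcl

/-- On `(0, s₀)` the function `besselSeries 1` has at most one zero. -/
theorem strictAntiOn_besselSeries_one {s₀ : ℝ} (h : ∀ s ∈ Ico 0 s₀, 0 < besselSeries 2 s) :
    StrictAntiOn (besselSeries 1) (Ico 0 s₀) := by
  refine strictAntiOn_of_deriv_neg (convex_Ico _ _) (continuous_besselSeries 1).continuousOn ?_
  intro s hs
  rw [interior_Ico] at hs
  rw [(hasDerivAt_besselSeries 1 s).deriv]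
  exact neg_lt_zero.2 (h s ⟨hs.1.le, hs.2⟩)

/-- A one-dimensional Hardy-type inequality (Jacobi's substitution), `p` being the radial
logarithmic derivative of a solution of Bessel's equation. -/
theorem integral_nonneg_of_riccati {a b M lam : ℝ} (ha : 0 < a) (hab : a ≤ b) {g g' p : ℝ → ℝ}
    (hg : ∀ r, HasDerivAt g (g' r) r) (hg' : Continuous g')
    (hp : ∀ r ∈ Ioo a b, HasDerivAt p ((M - p r ^ 2) / r - lam * r) r)
    (hF : ContinuousOn (fun r => g r ^ 2 * p r) (Icc a b)) (hga : g a = 0) (hgb : g b = 0) :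
    0 ≤ ∫ r in a..b, (r * g' r ^ 2 + (M / r - lam * r) * g r ^ 2) := by
  have hgc : Continuous g := continuous_iff_continuousAt.2 fun r => (hg r).continuousAt
  have hcont : ContinuousOn (fun r => r * g' r ^ 2 + (M / r - lam * r) * g r ^ 2) (Icc a b) := by
    have : ∀ r ∈ Icc a b, r ≠ 0 := fun r hr => (ha.trans_le hr.1).ne'
    fun_prop (disch := assumption)
  have key := intervalIntegral.sub_le_integral_of_hasDeriv_right_of_le hab hF
    (g' := fun r => 2 * g r * g' r * p r + g r ^ 2 * ((M - p r ^ 2) / r - lam * r))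
    (φ := fun r => r * g' r ^ 2 + (M / r - lam * r) * g r ^ 2)
    (fun r hr => by
      have h1 := ((hg r).pow 2).mul (hp r hr)
      exact (h1.congr_deriv (by simp)).hasDerivWithinAt)
    (hcont.integrableOn_Icc)
    (fun r hr => by
      have hr0 : 0 < r := ha.trans hr.1
      have : r * g' r ^ 2 + (M / r - lam * r) * g r ^ 2 -
          (2 * g r * g' r * p r + g r ^ 2 * ((M - p r ^ 2) / r - lam * r)) =
          r * (g' r - g r * p r / r) ^ 2 := by
        field_simp
        ring
      have h2 : 0 ≤ r * (g' r - g r * p r / r) ^ 2 := by positivity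
      linarith)
  simpa [hga, hgb] using key

section Radial

variable {c : ℝ}

theorem hasDerivAt_besselSeries_comp (m : ℕ) (c r : ℝ) :
    HasDerivAt (fun r => besselSeries m (c * r ^ 2))
      (-besselSeries (m + 1) (c * r ^ 2) * (2 * c * r)) r := by
  have h := (hasDerivAt_besselSeries m (c * r ^ 2)).comp r (((hasDerivAt_id r).pow 2).const_mul c)
  refine h.congr_deriv ?_
  simp only [id_eq, Nat.cast_ofNat]
  ring

/-- Riccati equation for the radial logarithmic derivative of `J_2`. -/
theorem hasDerivAt_riccati_two (hc : 0 < c) {r : ℝ} (hr : 0 < r)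
    (h : besselSeries 2 (c * r ^ 2) ≠ 0) :
    HasDerivAt (fun r => 2 * (besselSeries 1 (c * r ^ 2) / besselSeries 2 (c * r ^ 2)) - 2)
      ((4 - (2 * (besselSeries 1 (c * r ^ 2) / besselSeries 2 (c * r ^ 2)) - 2) ^ 2) / r
        - 4 * c * r) r := by
  have h1 := (((hasDerivAt_besselSeries_comp 1 c r).div
    (hasDerivAt_besselSeries_comp 2 c r) h).const_mul 2).sub_const 2
  have hrec := besselSeries_recurrence 1 (c * r ^ 2)
  refine h1.congr_deriv ?_
  norm_num at hrec ⊢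
  have h3 : besselSeries 3 (c * r ^ 2) = (2 * besselSeries 2 (c * r ^ 2) -
      besselSeries 1 (c * r ^ 2)) / (c * r ^ 2) := by
    field_simp
    linarith
  rw [h3]
  field_simp
  ring

/-- Riccati equation for the radial logarithmic derivative of `J_1`. -/
theorem hasDerivAt_riccati_one (hc : 0 < c) {r : ℝ} (hr : 0 < r)
    (h : besselSeries 1 (c * r ^ 2) ≠ 0) :
    HasDerivAt (fun r => 1 - 2 * (c * r ^ 2) * (besselSeries 2 (c * r ^ 2) /
        besselSeries 1 (c * r ^ 2)))
      ((1 - (1 - 2 * (c * r ^ 2) * (besselSeries 2 (c * r ^ 2) /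
        besselSeries 1 (c * r ^ 2))) ^ 2) / r - 4 * c * r) r := by
  have h1 := (((((hasDerivAt_id r).pow 2).const_mul c).const_mul 2).mul
    ((hasDerivAt_besselSeries_comp 2 c r).div (hasDerivAt_besselSeries_comp 1 c r) h)).const_sub 1
  have hrec := besselSeries_recurrence 1 (c * r ^ 2)
  refine h1.congr_deriv ?_
  norm_num at hrec ⊢
  have h3 : besselSeries 3 (c * r ^ 2) = (2 * besselSeries 2 (c * r ^ 2) -
      besselSeries 1 (c * r ^ 2)) / (c * r ^ 2) := by
    field_simp
    linarith
  rw [h3]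
  field_simp
  ring

theorem radial_inequality_two {R s₀ a b : ℝ} (hc : 0 < c) (hcR : c * R ^ 2 = s₀)
    (hs₀ : ∀ s ∈ Ico 0 s₀, 0 < besselSeries 2 s) (ha : 0 < a) (hab : a ≤ b) (hbR : b < R)
    {g g' : ℝ → ℝ} (hg : ∀ r, HasDerivAt g (g' r) r) (hg' : Continuous g')
    (hga : g a = 0) (hgb : g b = 0) :
    0 ≤ ∫ r in a..b, (r * g' r ^ 2 + (4 / r - 4 * c * r) * g r ^ 2) := by
  have hpos : ∀ r ∈ Icc a b, besselSeries 2 (c * r ^ 2) ≠ 0 := by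
    intro r hr
    refine (hs₀ _ ⟨by positivity, ?_⟩).ne'
    rw [← hcR]
    have : 0 < r := ha.trans_le hr.1
    have : r < R := hr.2.trans_lt hbR
    gcongr
  have hp : ∀ r ∈ Icc a b, _ := fun r hr =>
    hasDerivAt_riccati_two hc (ha.trans_le hr.1) (hpos r hr)
  have hgc : Continuous g := continuous_iff_continuousAt.2 fun r => (hg r).continuousAt
  exact integral_nonneg_of_riccati ha hab hg hg' (fun r hr => hp r (Ioo_subset_Icc_self hr))
    ((hgc.pow 2).continuousOn.mul fun r hr => (hp r hr).continuousAt.continuousWithinAt) hga hgb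

/-- There is a radius `r₀` such that, for functions vanishing at `r₀`, the radial form with angular
momentum one dominates the value `4c` given by the first zero of `J_2`. -/
theorem exists_radial_inequality_one {R s₀ : ℝ} (hc : 0 < c) (hR : 0 < R)
    (hcR : c * R ^ 2 = s₀)
    (hs₀ : ∀ s ∈ Ico 0 s₀, 0 < besselSeries 2 s) :
    ∃ r₀ : ℝ, 0 < r₀ ∧ ∀ a b : ℝ, 0 < a → a ≤ b → b < R → ∀ g g' : ℝ → ℝ,
      (∀ r, HasDerivAt g (g' r) r) → Continuous g' → g a = 0 → g b = 0 → g r₀ = 0 →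
      0 ≤ ∫ r in a..b, (r * g' r ^ 2 + (1 / r - 4 * c * r) * g r ^ 2) := by
  have hmem : ∀ r, 0 < r → r < R → c * r ^ 2 ∈ Ico 0 s₀ := by
    intro r h0 h1
    refine ⟨by positivity, ?_⟩
    rw [← hcR]
    gcongr
  have hanti := strictAntiOn_besselSeries_one hs₀
  obtain ⟨r₀, hr₀, huniq⟩ : ∃ r₀ : ℝ, 0 < r₀ ∧
      ∀ r, 0 < r → r < R → r ≠ r₀ → besselSeries 1 (c * r ^ 2) ≠ 0 := by
    by_cases h : ∃ r₀, 0 < r₀ ∧ r₀ < R ∧ besselSeries 1 (c * r₀ ^ 2) = 0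
    · obtain ⟨r₀, h0, h1, h2⟩ := h
      refine ⟨r₀, h0, fun r hr hrR hne h3 => hne ?_⟩
      have := hanti.injOn (hmem r hr hrR) (hmem r₀ h0 h1) (h3.trans h2.symm)
      have h4 : r ^ 2 = r₀ ^ 2 := mul_left_cancel₀ hc.ne' this
      exact (pow_left_inj₀ hr.le h0.le two_ne_zero).1 h4
    · push Not at h
      exact ⟨R, hR, fun r hr hrR _ => h r hr hrR⟩
  refine ⟨r₀, hr₀, fun a b ha hab hbR g g' hg hg' hga hgb hg₀ => ?_⟩
  have hgc : Continuous g := continuous_iff_continuousAt.2 fun r => (hg r).continuousAt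
  set p : ℝ → ℝ := fun r => 1 - 2 * (c * r ^ 2) * (besselSeries 2 (c * r ^ 2) /
        besselSeries 1 (c * r ^ 2)) with hpdef
  have hp : ∀ r, 0 < r → r < R → r ≠ r₀ →
      HasDerivAt p ((1 - p r ^ 2) / r - 4 * c * r) r := fun r h0 h1 h2 =>
    hasDerivAt_riccati_one hc h0 (huniq r h0 h1 h2)
  have hcomp : ∀ m : ℕ, Continuous fun r : ℝ => besselSeries m (c * r ^ 2) := fun m =>
    (continuous_besselSeries m).comp (by fun_prop)
  have hF : ∀ r, 0 < r → r < R → ContinuousAt (fun r => g r ^ 2 * p r) r := by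
    intro r h0 h1
    by_cases hr : besselSeries 1 (c * r ^ 2) = 0
    · have hrr : r = r₀ := by
        by_contra h
        exact huniq r h0 h1 h hr
      have hD := hasDerivAt_besselSeries_comp 1 c r
      have hD0 : -besselSeries (1 + 1) (c * r ^ 2) * (2 * c * r) ≠ 0 :=
        mul_ne_zero (neg_ne_zero.2 (hs₀ _ (hmem r h0 h1)).ne') (by positivity)
      have hs1 := hasDerivAt_iff_tendsto_slope.1 hD
      have hs2 := hasDerivAt_iff_tendsto_slope.1 (hg r)
      have hgr : g r = 0 := hrr ▸ hg₀
      have hq := hs2.div hs1 hD0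
      have hq' : Filter.Tendsto (fun y => g y / besselSeries 1 (c * y ^ 2)) (nhdsWithin r {r}ᶜ)
          (nhds (g' r / (-besselSeries (1 + 1) (c * r ^ 2) * (2 * c * r)))) := by
        refine hq.congr' ?_
        filter_upwards [self_mem_nhdsWithin] with y hy
        have hy' : y - r ≠ 0 := sub_ne_zero.2 hy
        simp only [Pi.div_apply, slope_def_field, hgr, hr, sub_zero]
        field_simp
      have hz : Filter.Tendsto (fun y => g y ^ 2 - 2 * (c * y ^ 2) * besselSeries 2 (c * y ^ 2) *
          g y * (g y / besselSeries 1 (c * y ^ 2))) (nhdsWithin r {r}ᶜ) (nhds 0) := by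
        have hcont : Filter.Tendsto (fun y => 2 * (c * y ^ 2) * besselSeries 2 (c * y ^ 2) *
            g y) (nhdsWithin r {r}ᶜ) (nhds 0) := by
          have : Continuous (fun y => 2 * (c * y ^ 2) * besselSeries 2 (c * y ^ 2) * g y) := by
            have := hcomp 2
            fun_prop
          have h := this.continuousAt (x := r)
          have h' := h.tendsto.mono_left (nhdsWithin_le_nhds (s := {r}ᶜ))
          simpa [hgr] using h'
        have hsq : Filter.Tendsto (fun y => g y ^ 2) (nhdsWithin r {r}ᶜ) (nhds 0) := by
          have h' := (hgc.pow 2).continuousAt (x := r) |>.tendsto.mono_left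
            (nhdsWithin_le_nhds (s := {r}ᶜ))
          rw [Pi.pow_apply, hgr, zero_pow two_ne_zero] at h'
          exact h'
        simpa using hsq.sub (hcont.mul hq')
      rw [continuousAt_iff_punctured_nhds]
      have : g r ^ 2 * p r = 0 := by simp [hgr]
      rw [this]
      refine hz.congr fun y => ?_
      simp only [hpdef]
      ring
    · have h2 := (hcomp 2).continuousAt (x := r)
      have h3 := (hcomp 1).continuousAt (x := r)
      have h4 := hgc.continuousAt (x := r)
      simp only [hpdef]
      fun_prop (disch := assumption)
  have hFon : ∀ a' b', 0 < a' → b' < R → ContinuousOn (fun r => g r ^ 2 * p r) (Icc a' b') :=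
    fun a' b' h0 h1 r hr =>
      (hF r (h0.trans_le hr.1) (hr.2.trans_lt h1)).continuousWithinAt
  by_cases hcase : r₀ ∈ Ioo a b
  · have hint : ∀ a' b', 0 < a' → a' ≤ b' → IntervalIntegrable
        (fun r => r * g' r ^ 2 + (1 / r - 4 * c * r) * g r ^ 2) volume a' b' := by
      intro a' b' h0 h1
      refine ContinuousOn.intervalIntegrable_of_Icc h1 ?_
      have : ∀ r ∈ Icc a' b', r ≠ 0 := fun r hr => (h0.trans_le hr.1).ne'
      fun_prop (disch := assumption)
    rw [← intervalIntegral.integral_add_adjacent_intervals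
      (hint a r₀ ha hcase.1.le) (hint r₀ b hr₀ hcase.2.le)]
    refine add_nonneg ?_ ?_
    · exact integral_nonneg_of_riccati ha hcase.1.le hg hg'
        (fun r hr => hp r (ha.trans hr.1) (hr.2.trans (hcase.2.trans hbR)) hr.2.ne)
        (hFon _ _ ha (hcase.2.trans hbR)) hga hg₀
    · exact integral_nonneg_of_riccati hr₀ hcase.2.le hg hg'
        (fun r hr => hp r (hr₀.trans hr.1) (hr.2.trans hbR) hr.1.ne')
        (hFon _ _ hr₀ hbR) hg₀ hgb
  · refine integral_nonneg_of_riccati ha hab hg hg'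
      (fun r hr => hp r (ha.trans hr.1) (hr.2.trans hbR) ?_) (hFon _ _ ha hbR) hga hgb
    rintro rfl
    exact hcase hr

end Radial

theorem wirtinger_two {f f' : ℝ → ℝ} (hf : ∀ x, HasDerivAt f (f' x) x) (hf' : Continuous f')
    (hper : f π = f (-π)) (h0 : ∫ x in (-π)..π, f x = 0)
    (hs : ∫ x in (-π)..π, f x * Real.sin x = 0) (hc : ∫ x in (-π)..π, f x * Real.cos x = 0) :
    4 * ∫ x in (-π)..π, f x ^ 2 ≤ ∫ x in (-π)..π, f' x ^ 2 := by
  have hab : -π < π := by linarith [Real.pi_pos]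
  have hfc : Continuous f := continuous_iff_continuousAt.2 fun r => (hf r).continuousAt
  have hL : ∀ g : ℝ → ℝ, Continuous g →
      MemLp (fun x => (g x : ℂ)) 2 (volume.restrict (Ioc (-π) π)) := by
    intro g hg
    have hg' : Continuous fun x => (g x : ℂ) := by fun_prop
    rw [memLp_two_iff_integrable_sq_norm hg'.aestronglyMeasurable]
    exact ((hg'.norm.pow 2).continuousOn.integrableOn_Icc).mono_set Ioc_subset_Icc_self
  have hF := hasSum_sq_fourierCoeffOn hab (hL f hfc)
  have hF' := hasSum_sq_fourierCoeffOn hab (hL f' hf')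
  have hcoef : ∀ n : ℤ, n ≠ 0 → ‖fourierCoeffOn hab (fun x => (f' x : ℂ)) n‖ ^ 2 =
      n ^ 2 * ‖fourierCoeffOn hab (fun x => (f x : ℂ)) n‖ ^ 2 := by
    intro n hn
    have h := fourierCoeffOn_of_hasDerivAt hab hn (f := fun x => (f x : ℂ))
      (f' := fun x => (f' x : ℂ)) (fun x _ => (hf x).ofReal_comp)
      ((Complex.continuous_ofReal.comp hf').intervalIntegrable _ _)
    have hn' : (n : ℂ) ≠ 0 := by exact_mod_cast hn
    have hpi : (π : ℂ) ≠ 0 := by exact_mod_cast Real.pi_ne_zero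
    rw [hper] at h
    have h2 : fourierCoeffOn hab (fun x => (f' x : ℂ)) n =
        Complex.I * n * fourierCoeffOn hab (fun x => (f x : ℂ)) n := by
      rw [h]
      push_cast
      field_simp
      ring_nf
    rw [h2]
    simp [mul_pow]
  have hcoef0 : ∀ n : ℤ, n ^ 2 < 4 → fourierCoeffOn hab (fun x => (f x : ℂ)) n = 0 := by
    intro n hn
    have hcs : ∀ a : ℝ, a = 0 ∨ a = 1 ∨ a = -1 → ∫ x in (-π)..π,
        Complex.exp (Complex.I * (a * x)) * (f x : ℂ) = 0 := by
      intro a ha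
      have he : ∀ x : ℝ, Complex.exp (Complex.I * (a * x)) * (f x : ℂ) =
          ((f x * Real.cos (a * x) : ℝ) : ℂ) + Complex.I * ((f x * Real.sin (a * x) : ℝ) : ℂ) := by
        intro x
        rw [mul_comm Complex.I, Complex.exp_mul_I]
        push_cast
        ring
      simp only [he]
      rw [intervalIntegral.integral_add (Continuous.intervalIntegrable (by fun_prop) _ _)
        (Continuous.intervalIntegrable (by fun_prop) _ _),
        intervalIntegral.integral_const_mul, intervalIntegral.integral_ofReal,
        intervalIntegral.integral_ofReal]
      rcases ha with rfl | rfl | rfl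
      · simp [h0]
      · simp [hs, hc]
      · simp [hs, hc]
    have hn3 : n = 0 ∨ n = 1 ∨ n = -1 := by
      have h1 : n < 2 := by nlinarith
      have h2 : -2 < n := by nlinarith
      omega
    rw [fourierCoeffOn_eq_integral]
    simp only [fourier_coe_apply, smul_eq_mul]
    have : ∀ x : ℝ, Complex.exp (2 * π * Complex.I * ((-n : ℤ) : ℂ) * x / ((π - -π : ℝ) : ℂ)) =
        Complex.exp (Complex.I * (((-n : ℝ) : ℂ) * x)) := by
      intro x
      have hpi : (π : ℂ) ≠ 0 := by exact_mod_cast Real.pi_ne_zero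
      congr 1
      push_cast
      field_simp
      ring
    simp only [this]
    rw [hcs]
    · simp
    · rcases hn3 with rfl | rfl | rfl <;> simp
  have hle : ∀ n : ℤ, 4 * ‖fourierCoeffOn hab (fun x => (f x : ℂ)) n‖ ^ 2 ≤
      ‖fourierCoeffOn hab (fun x => (f' x : ℂ)) n‖ ^ 2 := by
    intro n
    by_cases hn : n ^ 2 < 4
    · rw [hcoef0 n hn]
      simp
    · rw [hcoef n (by rintro rfl; simp at hn)]
      push Not at hn
      have : (4 : ℝ) ≤ (n : ℝ) ^ 2 := by exact_mod_cast hn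
      gcongr
  have := hasSum_le hle (hF.mul_left 4) hF'
  have hpos : 0 < (π - -π)⁻¹ := by
    rw [inv_pos]
    linarith
  simp only [smul_eq_mul, Complex.norm_real, Real.norm_eq_abs, sq_abs] at this
  rw [mul_left_comm] at this
  exact le_of_mul_le_mul_left this hpos

theorem integral_eq_polar_of_annulus {H : ℝ × ℝ → ℝ} (hH : Continuous H) {ρ b : ℝ} (hρ : 0 < ρ)
    (hb : ρ ≤ b) (h0 : ∀ x : ℝ × ℝ, x.1 ^ 2 + x.2 ^ 2 < ρ ^ 2 → H x = 0)
    (h1 : ∀ x : ℝ × ℝ, b ^ 2 < x.1 ^ 2 + x.2 ^ 2 → H x = 0) :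
    ∫ x, H x = ∫ r in ρ..b, ∫ θ in (-π)..π, r * H (r * Real.cos θ, r * Real.sin θ) := by
  have hπ : -π ≤ π := by linarith [Real.pi_pos]
  rw [← integral_comp_polarCoord_symm]
  have hsub : Icc ρ b ×ˢ Ioo (-π) π ⊆ polarCoord.target := by
    rintro ⟨r, θ⟩ ⟨hr, hθ⟩
    exact ⟨hρ.trans_le hr.1, hθ⟩
  rw [setIntegral_eq_of_subset_of_forall_sdiff_eq_zero polarCoord.open_target.measurableSet hsub]
  · have hF : Continuous fun p : ℝ × ℝ => p.1 • H (polarCoord.symm p) := by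
      simp only [polarCoord_symm_apply]
      fun_prop
    rw [Measure.volume_eq_prod, setIntegral_prod, intervalIntegral.integral_of_le hb,
      ← integral_Icc_eq_integral_Ioc]
    · refine setIntegral_congr_fun measurableSet_Icc fun r _ => ?_
      simp only [polarCoord_symm_apply, smul_eq_mul]
      rw [intervalIntegral.integral_of_le hπ, ← integral_Ioc_eq_integral_Ioo]
    · rw [← Measure.volume_eq_prod]
      exact (hF.continuousOn.integrableOn_compact (isCompact_Icc.prod isCompact_Icc)).mono_set
        (prod_mono_right Ioo_subset_Icc_self)
  · rintro ⟨r, θ⟩ ⟨⟨hr, hθ⟩, hn⟩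
    simp only [polarCoord_symm_apply, smul_eq_mul]
    have hr0 : 0 < r := hr
    have heq : (r * Real.cos θ) ^ 2 + (r * Real.sin θ) ^ 2 = r ^ 2 := by
      nlinarith [Real.sin_sq_add_cos_sq θ]
    have hr' : r ∉ Icc ρ b := fun h => hn ⟨h, hθ⟩
    rw [mem_Icc, not_and_or, not_le, not_le] at hr'
    rcases hr' with h | h
    · rw [h0, mul_zero]
      simp only [heq]
      gcongr
    · rw [h1, mul_zero]
      simp only [heq]
      have := hρ.le.trans hb
      gcongr

theorem integral_sub_mul_sq {f s : ℝ → ℝ} (hf : Continuous f) (hs : Continuous s) {α : ℝ}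
    (hss : ∫ x in (-π)..π, s x ^ 2 = π) (hfs : ∫ x in (-π)..π, f x * s x = π * α) :
    ∫ x in (-π)..π, (f x - α * s x) ^ 2 = (∫ x in (-π)..π, f x ^ 2) - π * α ^ 2 := by
  have h : ∀ x, (f x - α * s x) ^ 2 = f x ^ 2 - 2 * α * (f x * s x) + α ^ 2 * s x ^ 2 := by
    intro x
    ring
  simp only [h]
  rw [intervalIntegral.integral_add (Continuous.intervalIntegrable (by fun_prop) _ _)
    (Continuous.intervalIntegrable (by fun_prop) _ _), intervalIntegral.integral_sub
    (Continuous.intervalIntegrable (by fun_prop) _ _)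
    (Continuous.intervalIntegrable (by fun_prop) _ _), intervalIntegral.integral_const_mul,
    intervalIntegral.integral_const_mul, hss, hfs]
  ring

theorem integral_sin_sq_neg_pi_pi : ∫ x in (-π)..π, Real.sin x ^ 2 = π := by
  rw [integral_sin_sq]
  simp

theorem integral_cos_sq_neg_pi_pi : ∫ x in (-π)..π, Real.cos x ^ 2 = π := by
  rw [integral_cos_sq]
  simp

theorem intervalIntegral_eq_zero_of_odd {f : ℝ → ℝ} (hf : ∀ x, f (-x) = -f x) (a : ℝ) :
    ∫ x in (-a)..a, f x = 0 := by
  have h := intervalIntegral.integral_comp_neg (a := -a) (b := a) (f := f)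
  simp only [hf, neg_neg, intervalIntegral.integral_neg] at h
  linarith

theorem hasDerivAt_intervalIntegral_of_continuous {F F' : ℝ → ℝ → ℝ} {a b : ℝ}
    (hF : Continuous F.uncurry) (hF' : Continuous F'.uncurry)
    (hd : ∀ r t, HasDerivAt (fun r => F r t) (F' r t) r) (r : ℝ) :
    HasDerivAt (fun r => ∫ t in a..b, F r t) (∫ t in a..b, F' r t) r := by
  obtain ⟨C, hC⟩ := ((isCompact_closedBall r 1).prod (isCompact_uIcc (a := a) (b := b))).exists_bound_of_continuousOn
    hF'.continuousOn
  have hcF : ∀ r, Continuous (F r) := fun r => hF.comp (by fun_prop : Continuous fun t => (r, t))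
  have hcF' : ∀ r, Continuous (F' r) := fun r => hF'.comp (by fun_prop : Continuous fun t => (r, t))
  refine (intervalIntegral.hasDerivAt_integral_of_dominated_loc_of_deriv_le
    (s := Metric.closedBall r 1) (bound := fun _ => C) (Metric.closedBall_mem_nhds r one_pos)
    (Filter.Eventually.of_forall fun r => (hcF r).aestronglyMeasurable)
    ((hcF r).intervalIntegrable _ _) (hcF' r).aestronglyMeasurable
    (Filter.Eventually.of_forall fun t ht x hx => ?_)
    (continuous_const.intervalIntegrable _ _)
    (Filter.Eventually.of_forall fun t _ x _ => hd x t)).2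
  exact hC (x, t) ⟨hx, uIoc_subset_uIcc ht⟩

theorem intervalIntegral_swap_of_continuous {F : ℝ → ℝ → ℝ} (hF : Continuous F.uncurry)
    (a b c d : ℝ) : ∫ x in a..b, ∫ y in c..d, F x y = ∫ y in c..d, ∫ x in a..b, F x y :=
  MeasureTheory.intervalIntegral_intervalIntegral_swap
    ((hF.continuousOn.integrableOn_compact (isCompact_uIcc.prod isCompact_uIcc)).mono_set
      (prod_mono uIoc_subset_uIcc uIoc_subset_uIcc))

theorem fderiv_apply_pair (u : ℝ × ℝ → ℝ) (x : ℝ × ℝ) (a b : ℝ) :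
    fderiv ℝ u x (a, b) = a * fderiv ℝ u x (1, 0) + b * fderiv ℝ u x (0, 1) := by
  have : ((a, b) : ℝ × ℝ) = a • (1, 0) + b • (0, 1) := by ext <;> simp
  rw [this, map_add, map_smul, map_smul, smul_eq_mul, smul_eq_mul]

theorem continuous_gradSq {u : ℝ × ℝ → ℝ} (hu : ContDiff ℝ 1 u) : Continuous (gradSq u) := by
  have := hu.continuous_fderiv one_ne_zero
  unfold gradSq
  fun_prop

/-- Spectral gap for functions odd in `x₂` on a disc: if the first angular mode vanishes at a
suitable radius, the Rayleigh quotient is at least the first eigenvalue of angular momentum two. -/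
theorem mul_integral_sq_le_of_odd {c R s₀ : ℝ} (hc : 0 < c) (hcR : c * R ^ 2 = s₀)
    (hs₀ : ∀ s ∈ Ico 0 s₀, 0 < besselSeries 2 s) {r₀ : ℝ}
    (hr₀ : ∀ a b : ℝ, 0 < a → a ≤ b → b < R → ∀ g g' : ℝ → ℝ,
      (∀ r, HasDerivAt g (g' r) r) → Continuous g' → g a = 0 → g b = 0 → g r₀ = 0 →
      0 ≤ ∫ r in a..b, (r * g' r ^ 2 + (1 / r - 4 * c * r) * g r ^ 2))
    {U : ℝ × ℝ → ℝ} (hU : ContDiff ℝ 1 U) (hodd : ∀ x y, U (x, -y) = -U (x, y))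
    {ρ b : ℝ} (hρ : 0 < ρ) (hb : ρ ≤ b) (hbR : b < R)
    (h0 : ∀ x : ℝ × ℝ, x.1 ^ 2 + x.2 ^ 2 ≤ ρ ^ 2 → U x = 0)
    (h1 : ∀ x : ℝ × ℝ, b ^ 2 ≤ x.1 ^ 2 + x.2 ^ 2 → U x = 0)
    (hconstr : ∫ θ in (-π)..π, U (r₀ * Real.cos θ, r₀ * Real.sin θ) * Real.sin θ = 0) :
    4 * c * ∫ x, U x ^ 2 ≤ ∫ x, gradSq U x := by
  have hUc := hU.continuous
  have hfd := hU.continuous_fderiv one_ne_zero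
  have hUd : ∀ x, HasFDerivAt U (fderiv ℝ U x) x := fun x =>
    (hU.differentiable one_ne_zero x).hasFDerivAt
  have hg0 : ∀ x : ℝ × ℝ, x.1 ^ 2 + x.2 ^ 2 < ρ ^ 2 → gradSq U x = 0 := by
    intro x hx
    have : U =ᶠ[nhds x] fun _ => 0 := by
      filter_upwards [(isOpen_lt (by fun_prop : Continuous fun x : ℝ × ℝ => x.1 ^ 2 + x.2 ^ 2)
        continuous_const).mem_nhds hx] with y hy using h0 y (le_of_lt hy)
    simp [gradSq, this.fderiv_eq]
  have hg1 : ∀ x : ℝ × ℝ, b ^ 2 < x.1 ^ 2 + x.2 ^ 2 → gradSq U x = 0 := by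
    intro x hx
    have : U =ᶠ[nhds x] fun _ => 0 := by
      filter_upwards [(isOpen_lt continuous_const (by fun_prop : Continuous fun x : ℝ × ℝ =>
        x.1 ^ 2 + x.2 ^ 2)).mem_nhds hx] with y hy using h1 y (le_of_lt hy)
    simp [gradSq, this.fderiv_eq]
  rw [integral_eq_polar_of_annulus (continuous_gradSq hU) hρ hb hg0 hg1,
    integral_eq_polar_of_annulus (H := fun x => U x ^ 2) (by fun_prop) hρ hb
      (fun x hx => by simp [h0 x hx.le]) (fun x hx => by simp [h1 x hx.le]),
    ← intervalIntegral.integral_const_mul]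
  -- polar derivatives
  set W : ℝ → ℝ → ℝ := fun r θ => U (r * Real.cos θ, r * Real.sin θ) with hW
  set Wr : ℝ → ℝ → ℝ := fun r θ =>
    fderiv ℝ U (r * Real.cos θ, r * Real.sin θ) (Real.cos θ, Real.sin θ) with hWr
  set Wt : ℝ → ℝ → ℝ := fun r θ =>
    fderiv ℝ U (r * Real.cos θ, r * Real.sin θ) (-(r * Real.sin θ), r * Real.cos θ) with hWt
  have hWc : Continuous W.uncurry := by
    simp only [hW, Function.uncurry_def]
    fun_prop
  have hWrc : Continuous Wr.uncurry := by
    simp only [hWr, Function.uncurry_def]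
    fun_prop
  have hWtc : Continuous Wt.uncurry := by
    simp only [hWt, Function.uncurry_def]
    fun_prop
  have hdr : ∀ r θ, HasDerivAt (fun r => W r θ) (Wr r θ) r := by
    intro r θ
    have h := ((hasDerivAt_id r).mul_const (Real.cos θ)).prodMk
      ((hasDerivAt_id r).mul_const (Real.sin θ))
    have h2 := (hUd (r * Real.cos θ, r * Real.sin θ)).comp_hasDerivAt r h
    exact h2.congr_deriv (by simp [hWr])
  have hdt : ∀ r θ, HasDerivAt (fun θ => W r θ) (Wt r θ) θ := by
    intro r θ
    have h := ((Real.hasDerivAt_cos θ).const_mul r).prodMk ((Real.hasDerivAt_sin θ).const_mul r)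
    have h2 := (hUd (r * Real.cos θ, r * Real.sin θ)).comp_hasDerivAt θ h
    exact h2.congr_deriv (by simp [hWt])
  have hgrad : ∀ r θ, r ^ 2 * gradSq U (r * Real.cos θ, r * Real.sin θ) =
      r ^ 2 * Wr r θ ^ 2 + Wt r θ ^ 2 := by
    intro r θ
    simp only [hWr, hWt, gradSq]
    rw [fderiv_apply_pair _ _ (Real.cos θ), fderiv_apply_pair _ _ (-(r * Real.sin θ))]
    have hsc := Real.sin_sq_add_cos_sq θ
    set A := fderiv ℝ U (r * Real.cos θ, r * Real.sin θ) (1, 0)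
    set B := fderiv ℝ U (r * Real.cos θ, r * Real.sin θ) (0, 1)
    linear_combination (-(r ^ 2 * (A ^ 2 + B ^ 2))) * hsc
  -- the first angular mode
  set a : ℝ → ℝ := fun r => π⁻¹ * ∫ θ in (-π)..π, W r θ * Real.sin θ with ha
  set a' : ℝ → ℝ := fun r => π⁻¹ * ∫ θ in (-π)..π, Wr r θ * Real.sin θ with ha'
  have hWsc : Continuous (fun r θ => W r θ * Real.sin θ : ℝ → ℝ → ℝ).uncurry := by
    simp only [Function.uncurry_def] at hWc ⊢
    fun_prop
  have hWrsc : Continuous (fun r θ => Wr r θ * Real.sin θ : ℝ → ℝ → ℝ).uncurry := by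
    simp only [Function.uncurry_def] at hWrc ⊢
    fun_prop
  have hda : ∀ r, HasDerivAt a (a' r) r := fun r =>
    (hasDerivAt_intervalIntegral_of_continuous hWsc hWrsc
      (fun r θ => (hdr r θ).mul_const _) r).const_mul _
  have hac : Continuous a := continuous_iff_continuousAt.2 fun r => (hda r).continuousAt
  have ha'c : Continuous a' := by
    have := intervalIntegral.continuous_parametric_intervalIntegral_of_continuous' hWrsc (-π) π (μ := volume)
    simp only [ha']
    fun_prop
  have hapi : ∀ r, ∫ θ in (-π)..π, W r θ * Real.sin θ = π * a r := by
    intro r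
    simp only [ha]
    field_simp
  have ha'pi : ∀ r, ∫ θ in (-π)..π, Wr r θ * Real.sin θ = π * a' r := by
    intro r
    simp only [ha']
    field_simp
  have hWzero : ∀ r θ, (r ^ 2 ≤ ρ ^ 2 ∨ b ^ 2 ≤ r ^ 2) → W r θ = 0 := by
    intro r θ h
    have heq : (r * Real.cos θ) ^ 2 + (r * Real.sin θ) ^ 2 = r ^ 2 := by
      nlinarith [Real.sin_sq_add_cos_sq θ]
    rcases h with h | h
    · exact h0 _ (by simpa only [heq] using h)
    · exact h1 _ (by simpa only [heq] using h)
  have haρ : a ρ = 0 := by simp [ha, hWzero ρ _ (Or.inl le_rfl)]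
  have hab : a b = 0 := by simp [ha, hWzero b _ (Or.inr le_rfl)]
  have har₀ : a r₀ = 0 := by
    simp only [ha, hW]
    rw [hconstr, mul_zero]
  have hrad1 := hr₀ ρ b hρ hb hbR a a' hda ha'c haρ hab har₀
  -- the remaining angular modes
  have hoddW : ∀ r θ, W r (-θ) = -W r θ := by
    intro r θ
    simp only [hW, Real.cos_neg, Real.sin_neg, mul_neg, hodd]
  have hWcr : ∀ r, Continuous (W r) := fun r => hWc.comp (by fun_prop : Continuous fun t => (r, t))
  have hWrcr : ∀ r, Continuous (Wr r) := fun r =>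
    hWrc.comp (by fun_prop : Continuous fun t => (r, t))
  have hWtcr : ∀ r, Continuous (Wt r) := fun r =>
    hWtc.comp (by fun_prop : Continuous fun t => (r, t))
  have hWtcos : ∀ r, ∫ θ in (-π)..π, Wt r θ * Real.cos θ = π * a r := by
    intro r
    have h := intervalIntegral.integral_deriv_mul_eq_sub (a := -π) (b := π)
      (u := W r) (v := Real.cos) (u' := Wt r) (v' := fun θ => -Real.sin θ)
      (fun θ _ => hdt r θ) (fun θ _ => Real.hasDerivAt_cos θ)
      ((hWtcr r).intervalIntegrable _ _)
      ((by fun_prop : Continuous fun θ : ℝ => -Real.sin θ).intervalIntegrable _ _)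
    have hWcr' := hWcr r
    have hWtcr' := hWtcr r
    rw [intervalIntegral.integral_add (Continuous.intervalIntegrable (by fun_prop) _ _)
      (Continuous.intervalIntegrable (by fun_prop) _ _)] at h
    simp only [mul_neg, intervalIntegral.integral_neg, hapi] at h
    have hz : W r π = 0 := by
      have h1 : W r (-π) = W r π := by simp [hW]
      have h2 := hoddW r π
      linarith
    have hz' : W r (-π) = 0 := by rw [hoddW, hz, neg_zero]
    rw [hz, hz'] at h
    linarith
  have hwirt : ∀ r, 4 * ((∫ θ in (-π)..π, W r θ ^ 2) - π * a r ^ 2) ≤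
      (∫ θ in (-π)..π, Wt r θ ^ 2) - π * a r ^ 2 := by
    intro r
    rw [← integral_sub_mul_sq (hWcr r) Real.continuous_sin integral_sin_sq_neg_pi_pi (hapi r),
      ← integral_sub_mul_sq (hWtcr r) Real.continuous_cos integral_cos_sq_neg_pi_pi (hWtcos r)]
    have hWcr' := hWcr r
    have hWtcr' := hWtcr r
    refine wirtinger_two (fun θ => (hdt r θ).sub ((Real.hasDerivAt_sin θ).const_mul _))
      (by fun_prop) ?_ ?_ ?_ ?_
    · simp [hW]
    · exact intervalIntegral_eq_zero_of_odd
        (fun θ => by rw [hoddW, Real.sin_neg]; ring) π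
    · have h : ∀ x, (W r x - a r * Real.sin x) * Real.sin x =
          W r x * Real.sin x - a r * Real.sin x ^ 2 := fun x => by ring
      simp only [h]
      rw [intervalIntegral.integral_sub (Continuous.intervalIntegrable (by fun_prop) _ _)
        (Continuous.intervalIntegrable (by fun_prop) _ _), intervalIntegral.integral_const_mul,
        integral_sin_sq_neg_pi_pi, hapi]
      ring
    · exact intervalIntegral_eq_zero_of_odd
        (fun θ => by rw [hoddW, Real.sin_neg, Real.cos_neg]; ring) π
  have hrad2 : 0 ≤ ∫ r in ρ..b, ∫ θ in (-π)..π, (r * (Wr r θ - a' r * Real.sin θ) ^ 2 +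
      (4 / max r ρ - 4 * c * r) * (W r θ - a r * Real.sin θ) ^ 2) := by
    rw [intervalIntegral_swap_of_continuous]
    · refine intervalIntegral.integral_nonneg (by linarith [Real.pi_pos]) fun θ _ => ?_
      have h := radial_inequality_two hc hcR hs₀ hρ hb hbR
        (g := fun r => W r θ - a r * Real.sin θ) (g' := fun r => Wr r θ - a' r * Real.sin θ)
        (fun r => (hdr r θ).sub ((hda r).mul_const _)) (by
          have : Continuous fun r => Wr r θ :=
            hWrc.comp (by fun_prop : Continuous fun r => (r, θ))
          fun_prop) (by simp [hWzero ρ _ (Or.inl le_rfl), haρ])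
        (by simp [hWzero b _ (Or.inr le_rfl), hab])
      refine h.trans_eq (intervalIntegral.integral_congr fun r hr => ?_)
      rw [uIcc_of_le hb] at hr
      simp only [max_eq_left hr.1]
    · simp only [Function.uncurry_def] at hWc hWrc ⊢
      have : ∀ x : ℝ × ℝ, max x.1 ρ ≠ 0 := fun x => (lt_max_of_lt_right hρ).ne'
      fun_prop (disch := assumption)
  -- combine
  have hparam : ∀ F : ℝ → ℝ → ℝ, Continuous F.uncurry →
      Continuous fun r => ∫ θ in (-π)..π, F r θ := fun F hF =>
    intervalIntegral.continuous_parametric_intervalIntegral_of_continuous' hF (-π) π (μ := volume)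
  have hUg : Continuous (gradSq U) := continuous_gradSq hU
  rw [← sub_nonneg, ← intervalIntegral.integral_sub]
  rotate_left
  · refine (hparam _ ?_).intervalIntegrable _ _
    simp only [Function.uncurry_def]
    fun_prop
  · refine ((hparam _ ?_).const_mul _).intervalIntegrable _ _
    simp only [Function.uncurry_def]
    fun_prop
  have hint1 : IntervalIntegrable (fun r => r * a' r ^ 2 + (1 / r - 4 * c * r) * a r ^ 2)
      volume ρ b := by
    refine ContinuousOn.intervalIntegrable_of_Icc hb ?_
    have : ∀ r ∈ Icc ρ b, r ≠ 0 := fun r hr => (hρ.trans_le hr.1).ne'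
    fun_prop (disch := assumption)
  have hcont2 : Continuous (fun r θ => r * (Wr r θ - a' r * Real.sin θ) ^ 2 +
      (4 / max r ρ - 4 * c * r) * (W r θ - a r * Real.sin θ) ^ 2 : ℝ → ℝ → ℝ).uncurry := by
    simp only [Function.uncurry_def] at hWc hWrc ⊢
    have : ∀ x : ℝ × ℝ, max x.1 ρ ≠ 0 := fun x => (lt_max_of_lt_right hρ).ne'
    fun_prop (disch := assumption)
  have hsum := add_nonneg hrad2 (mul_nonneg Real.pi_pos.le hrad1)
  rw [← intervalIntegral.integral_const_mul, ← intervalIntegral.integral_add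
    ((hparam _ hcont2).intervalIntegrable _ _) (hint1.const_mul _)] at hsum
  refine hsum.trans (intervalIntegral.integral_mono_on hb
    (((hparam _ hcont2).intervalIntegrable _ _).add (hint1.const_mul _)) ?_ ?_)
  · refine Continuous.intervalIntegrable (Continuous.sub (hparam _ ?_)
      ((hparam _ ?_).const_mul _)) _ _
    · simp only [Function.uncurry_def]
      fun_prop
    · simp only [Function.uncurry_def]
      fun_prop
  intro r hr
  have hr0 : 0 < r := hρ.trans_le hr.1
  have hWcr' := hWcr r
  have hWtcr' := hWtcr r
  have hWrcr' := hWrcr r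
  rw [intervalIntegral.integral_add (Continuous.intervalIntegrable (by fun_prop) _ _)
      (Continuous.intervalIntegrable (by fun_prop) _ _), intervalIntegral.integral_const_mul,
      intervalIntegral.integral_const_mul,
      integral_sub_mul_sq (hWcr r) Real.continuous_sin integral_sin_sq_neg_pi_pi (hapi r),
      integral_sub_mul_sq (hWrcr r) Real.continuous_sin integral_sin_sq_neg_pi_pi (ha'pi r),
      max_eq_left hr.1]
  have hgr : ∀ θ, r * gradSq U (r * Real.cos θ, r * Real.sin θ) =
      r * Wr r θ ^ 2 + r⁻¹ * Wt r θ ^ 2 := by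
    intro θ
    have := hgrad r θ
    field_simp
    linarith
  simp only [hgr]
  rw [intervalIntegral.integral_add (Continuous.intervalIntegrable (by fun_prop) _ _)
      (Continuous.intervalIntegrable (by fun_prop) _ _), intervalIntegral.integral_const_mul,
      intervalIntegral.integral_const_mul, intervalIntegral.integral_const_mul]
  have h := mul_le_mul_of_nonneg_left (hwirt r) (inv_pos.2 hr0).le
  change _ ≤ r * (∫ x in (-π)..π, Wr r x ^ 2) + r⁻¹ * (∫ x in (-π)..π, Wt r x ^ 2) -
    4 * c * (r * ∫ x in (-π)..π, W r x ^ 2)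
  rw [div_eq_mul_inv, div_eq_mul_inv]
  linarith

theorem gradSq_eq_zero_of_notMem_tsupport {u : ℝ × ℝ → ℝ} {x : ℝ × ℝ} (hx : x ∉ tsupport u) :
    gradSq u x = 0 := by
  have : fderiv ℝ u x = 0 := fderiv_of_notMem_tsupport (𝕜 := ℝ) hx
  simp [gradSq, this]

theorem gradSq_nonneg (u : ℝ × ℝ → ℝ) (x : ℝ × ℝ) : 0 ≤ gradSq u x := by
  unfold gradSq
  positivity

theorem rayleigh_eq_of_testFun {ω : Set (ℝ × ℝ)} {u : ℝ × ℝ → ℝ} (hu : testFun ω u) :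
    rayleigh ω u = (∫ x, gradSq u x) / ∫ x, u x ^ 2 := by
  rw [rayleigh, setIntegral_eq_integral_of_forall_compl_eq_zero,
    setIntegral_eq_integral_of_forall_compl_eq_zero]
  · intro x hx
    rw [image_eq_zero_of_notMem_tsupport fun h => hx (hu.2.2 h)]
    norm_num
  · exact fun x hx => gradSq_eq_zero_of_notMem_tsupport fun h => hx (hu.2.2 h)

theorem testFun.contDiff_one {ω : Set (ℝ × ℝ)} {u : ℝ × ℝ → ℝ} (hu : testFun ω u) :
    ContDiff ℝ 1 u := hu.1.of_le (by exact_mod_cast le_top)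

theorem integral_comp_reflection {s t : ℝ} (hs : s ^ 2 = 1) (ht : t ^ 2 = 1) {H : ℝ × ℝ → ℝ}
    (hH : Continuous H) : ∫ x : ℝ × ℝ, H (s * x.1, t * x.2) = ∫ x, H x := by
  have hmp : ∀ s : ℝ, s ^ 2 = 1 → MeasurePreserving (fun x : ℝ => s * x) volume volume := by
    intro s hs
    have hs0 : s ≠ 0 := by
      rintro rfl
      norm_num at hs
    refine ⟨by fun_prop, ?_⟩
    have h := Real.smul_map_volume_mul_left hs0
    rwa [show |s| = 1 from
      (pow_eq_one_iff_of_nonneg (abs_nonneg s) two_ne_zero).1 (by rw [sq_abs, hs]),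
      ENNReal.ofReal_one, one_smul] at h
  have h := (hmp s hs).prod (hmp t ht)
  rw [← Measure.volume_eq_prod] at h
  have h2 := integral_map (μ := volume) h.measurable.aemeasurable
    (f := H) (by rw [h.map_eq]; exact hH.aestronglyMeasurable)
  rw [h.map_eq] at h2
  exact h2.symm

theorem fderiv_comp_reflection {s t : ℝ} {u : ℝ × ℝ → ℝ} (hu : ContDiff ℝ 1 u) (x v : ℝ × ℝ) :
    fderiv ℝ (fun x : ℝ × ℝ => u (s * x.1, t * x.2)) x v =
      fderiv ℝ u (s * x.1, t * x.2) (s * v.1, t * v.2) := by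
  have h1 : HasFDerivAt (fun x : ℝ × ℝ => (s * x.1, t * x.2))
      ((s • ContinuousLinearMap.fst ℝ ℝ ℝ).prod (t • ContinuousLinearMap.snd ℝ ℝ ℝ)) x :=
    (hasFDerivAt_fst.const_mul s).prodMk (hasFDerivAt_snd.const_mul t)
  have h2 := ((hu.differentiable one_ne_zero (s * x.1, t * x.2)).hasFDerivAt).comp x h1
  have h3 := h2.fderiv
  simp only [Function.comp_def] at h3
  rw [h3]
  simp

theorem gradSq_add_reflection {s t : ℝ} (hs : s ^ 2 = 1) (ht : t ^ 2 = 1) {u : ℝ × ℝ → ℝ}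
    (hu : ContDiff ℝ 1 u) (hdis : ∀ x ∈ tsupport u, (s * x.1, t * x.2) ∉ tsupport u)
    (α β : ℝ) (x : ℝ × ℝ) :
    gradSq (fun x => α * u x + β * u (s * x.1, t * x.2)) x =
      α ^ 2 * gradSq u x + β ^ 2 * gradSq u (s * x.1, t * x.2) := by
  have hd := (hu.differentiable one_ne_zero x).hasFDerivAt
  have hur : ContDiff ℝ 1 (fun x : ℝ × ℝ => u (s * x.1, t * x.2)) :=
    hu.comp (by fun_prop : ContDiff ℝ 1 fun x : ℝ × ℝ => (s * x.1, t * x.2))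
  have hd' := (hur.differentiable one_ne_zero x).hasFDerivAt
  have h := ((hd.const_mul α).add (hd'.const_mul β)).fderiv
  change fderiv ℝ (fun x => α * u x + β * u (s * x.1, t * x.2)) x = _ at h
  unfold gradSq
  rw [h]
  simp only [add_apply, smul_apply, smul_eq_mul, fderiv_comp_reflection hu, mul_one, mul_zero]
  rw [fderiv_apply_pair _ _ s, fderiv_apply_pair _ _ 0 t]
  by_cases hx : x ∈ tsupport u
  · simp [fderiv_of_notMem_tsupport (𝕜 := ℝ) (hdis x hx)]
    ring
  · simp [fderiv_of_notMem_tsupport (𝕜 := ℝ) hx]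
    linear_combination (β ^ 2 * fderiv ℝ u (s * x.1, t * x.2) (1, 0) ^ 2) * hs +
      (β ^ 2 * fderiv ℝ u (s * x.1, t * x.2) (0, 1) ^ 2) * ht

theorem integrable_gradSq {u : ℝ × ℝ → ℝ} (hu : ContDiff ℝ 1 u) (hc : HasCompactSupport u) :
    Integrable (gradSq u) :=
  (continuous_gradSq hu).integrable_of_hasCompactSupport
    (HasCompactSupport.intro hc fun _ => gradSq_eq_zero_of_notMem_tsupport)

theorem hasCompactSupport_sq {u : ℝ × ℝ → ℝ} (hc : HasCompactSupport u) :
    HasCompactSupport fun x => u x ^ 2 :=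
  HasCompactSupport.intro hc fun x hx => by
    rw [image_eq_zero_of_notMem_tsupport hx, zero_pow two_ne_zero]

theorem integrable_sq_of_hasCompactSupport {u : ℝ × ℝ → ℝ} (hu : Continuous u)
    (hc : HasCompactSupport u) : Integrable fun x => u x ^ 2 := by
  have h : Continuous fun x => u x ^ 2 := by fun_prop
  exact h.integrable_of_hasCompactSupport (hasCompactSupport_sq hc)

theorem integrable_comp_reflection {s t : ℝ} (hs : s ^ 2 = 1) (ht : t ^ 2 = 1) {H : ℝ × ℝ → ℝ}
    (hH : Continuous H) (hc : HasCompactSupport H) :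
    Integrable fun x : ℝ × ℝ => H (s * x.1, t * x.2) := by
  have hH' : Continuous fun x : ℝ × ℝ => H (s * x.1, t * x.2) := by fun_prop
  refine hH'.integrable_of_hasCompactSupport
    (HasCompactSupport.intro (hc.image (f := fun x : ℝ × ℝ => (s * x.1, t * x.2)) (by fun_prop))
      fun x hx => ?_)
  refine image_eq_zero_of_notMem_tsupport (f := H) fun h => hx ⟨_, h, ?_⟩
  ext
  · simp only
    linear_combination x.1 * hs
  · simp only
    linear_combination x.2 * ht

theorem integral_gradSq_add_reflection {s t : ℝ} (hs : s ^ 2 = 1) (ht : t ^ 2 = 1)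
    {u : ℝ × ℝ → ℝ} (hu : ContDiff ℝ 1 u) (hc : HasCompactSupport u)
    (hdis : ∀ x ∈ tsupport u, (s * x.1, t * x.2) ∉ tsupport u) (α β : ℝ) :
    ∫ x, gradSq (fun x => α * u x + β * u (s * x.1, t * x.2)) x =
      (α ^ 2 + β ^ 2) * ∫ x, gradSq u x := by
  simp only [gradSq_add_reflection hs ht hu hdis]
  rw [integral_add ((integrable_gradSq hu hc).const_mul _)
    ((integrable_comp_reflection hs ht (continuous_gradSq hu)
      (HasCompactSupport.intro hc fun _ => gradSq_eq_zero_of_notMem_tsupport)).const_mul _),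
    integral_const_mul, integral_const_mul, integral_comp_reflection hs ht (continuous_gradSq hu)]
  ring

theorem integral_sq_add_reflection {s t : ℝ} (hs : s ^ 2 = 1) (ht : t ^ 2 = 1)
    {u : ℝ × ℝ → ℝ} (hu : Continuous u) (hc : HasCompactSupport u)
    (hdis : ∀ x ∈ tsupport u, (s * x.1, t * x.2) ∉ tsupport u) (α β : ℝ) :
    ∫ x : ℝ × ℝ, (α * u x + β * u (s * x.1, t * x.2)) ^ 2 = (α ^ 2 + β ^ 2) * ∫ x, u x ^ 2 := by
  have h : ∀ x : ℝ × ℝ, (α * u x + β * u (s * x.1, t * x.2)) ^ 2 =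
      α ^ 2 * u x ^ 2 + β ^ 2 * u (s * x.1, t * x.2) ^ 2 := by
    intro x
    by_cases hx : x ∈ tsupport u
    · rw [image_eq_zero_of_notMem_tsupport (hdis x hx)]
      ring
    · rw [image_eq_zero_of_notMem_tsupport hx]
      ring
  simp only [h]
  have hu2 : Continuous fun x => u x ^ 2 := by fun_prop
  rw [integral_add ((integrable_sq_of_hasCompactSupport hu hc).const_mul _)
    ((integrable_comp_reflection hs ht hu2
      (hasCompactSupport_sq hc)).const_mul _),
    integral_const_mul, integral_const_mul, integral_comp_reflection hs ht hu2]
  ring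

theorem integral_sq_pos {u : ℝ × ℝ → ℝ} (hu : Continuous u) (hc : HasCompactSupport u)
    (h0 : u ≠ 0) : 0 < ∫ x, u x ^ 2 := by
  obtain ⟨x, hx⟩ := Function.ne_iff.1 h0
  have hu2 : Continuous fun x => u x ^ 2 := by fun_prop
  exact hu2.integral_pos_of_hasCompactSupport_nonneg_nonzero
    (hasCompactSupport_sq hc) (fun _ => sq_nonneg _)
    (x := x) (pow_ne_zero 2 hx)

theorem rayleigh_nonneg (ω : Set (ℝ × ℝ)) (u : ℝ × ℝ → ℝ) : 0 ≤ rayleigh ω u :=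
  div_nonneg (integral_nonneg fun x => gradSq_nonneg u x) (integral_nonneg fun _ => sq_nonneg _)

theorem bddBelow_dirichletEV_set (ω : Set (ℝ × ℝ)) (k : ℕ) :
    BddBelow {l | ∃ V : Submodule ℝ ((ℝ × ℝ) → ℝ),
      (V : Set ((ℝ × ℝ) → ℝ)) ⊆ {u | testFun ω u} ∧ Module.finrank ℝ V = k ∧
      l = sSup {r | ∃ u ∈ V, u ≠ 0 ∧ r = rayleigh ω u}} := by
  refine ⟨0, ?_⟩
  rintro l ⟨V, -, -, rfl⟩
  refine Real.sSup_nonneg ?_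
  rintro r ⟨u, -, -, rfl⟩
  exact rayleigh_nonneg ω u

theorem dirichletEV_anti {ω ω' : Set (ℝ × ℝ)} (h : ω ⊆ ω') {k : ℕ}
    (hne : ∃ V : Submodule ℝ ((ℝ × ℝ) → ℝ),
      (V : Set ((ℝ × ℝ) → ℝ)) ⊆ {u | testFun ω u} ∧ Module.finrank ℝ V = k) :
    dirichletEV ω' k ≤ dirichletEV ω k := by
  obtain ⟨V₀, hV₀, hk₀⟩ := hne
  refine csInf_le_csInf (bddBelow_dirichletEV_set ω' k) ⟨_, V₀, hV₀, hk₀, rfl⟩ ?_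
  rintro l ⟨V, hV, hk, rfl⟩
  refine ⟨V, fun u hu => ⟨(hV hu).1, (hV hu).2.1, (hV hu).2.2.trans h⟩, hk, ?_⟩
  congr 1
  ext r
  refine exists_congr fun u => and_congr_right fun hu => and_congr_right fun _ => ?_
  have hu' := hV hu
  rw [rayleigh_eq_of_testFun hu',
    rayleigh_eq_of_testFun (ω := ω') ⟨hu'.1, hu'.2.1, hu'.2.2.trans h⟩]

theorem gradSq_linearCombination_le {u v : ℝ × ℝ → ℝ} (hu : ContDiff ℝ 1 u)
    (hv : ContDiff ℝ 1 v) (x y : ℝ) (p : ℝ × ℝ) :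
    gradSq (x • u + y • v) p ≤ 2 * x ^ 2 * gradSq u p + 2 * y ^ 2 * gradSq v p := by
  have h := (((hu.differentiable one_ne_zero p).hasFDerivAt.const_smul x).add
    ((hv.differentiable one_ne_zero p).hasFDerivAt.const_smul y)).fderiv
  unfold gradSq
  rw [h]
  simp only [add_apply, smul_apply, smul_eq_mul]
  nlinarith [sq_nonneg (x * fderiv ℝ u p (1, 0) - y * fderiv ℝ v p (1, 0)),
    sq_nonneg (x * fderiv ℝ u p (0, 1) - y * fderiv ℝ v p (0, 1))]

theorem bddAbove_rayleigh {ω : Set (ℝ × ℝ)} {V : Submodule ℝ ((ℝ × ℝ) → ℝ)}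
    (hV : (V : Set ((ℝ × ℝ) → ℝ)) ⊆ {u | testFun ω u}) (hk : Module.finrank ℝ V = 2) :
    BddAbove {r | ∃ u ∈ V, u ≠ 0 ∧ r = rayleigh ω u} := by
  have : Module.Finite ℝ V := Module.finite_of_finrank_pos (by omega)
  let b := Module.finBasisOfFinrankEq ℝ V hk
  set u : ℝ × ℝ → ℝ := (b 0).1 with hu_def
  set v : ℝ × ℝ → ℝ := (b 1).1 with hv_def
  have hrep : ∀ w ∈ V, ∃ x y : ℝ, w = x • u + y • v := by
    intro w hw
    refine ⟨b.repr ⟨w, hw⟩ 0, b.repr ⟨w, hw⟩ 1, ?_⟩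
    have h := congrArg Subtype.val (b.sum_repr ⟨w, hw⟩)
    rw [Fin.sum_univ_two] at h
    exact h.symm
  have hu : testFun ω u := hV (b 0).2
  have hv : testFun ω v := hV (b 1).2
  have hne : ∀ x y : ℝ, x ≠ 0 ∨ y ≠ 0 → x • u + y • v ≠ 0 := by
    intro x y hxy h0
    have hli := b.linearIndependent
    rw [Fintype.linearIndependent_iff] at hli
    have h := hli ![x, y] (by
      rw [Fin.sum_univ_two]
      exact Subtype.ext h0)
    rcases hxy with hx | hy
    · exact hx (h 0)
    · exact hy (h 1)
  have huc := hu.1.continuous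
  have hvc := hv.1.continuous
  have hiu := integrable_sq_of_hasCompactSupport huc hu.2.1
  have hiv := integrable_sq_of_hasCompactSupport hvc hv.2.1
  have hiuv : Integrable fun p => u p * v p := by
    have : Continuous fun p => u p * v p := by fun_prop
    exact this.integrable_of_hasCompactSupport hu.2.1.mul_right
  have hD : ∀ x y : ℝ, ∫ p, (x • u + y • v) p ^ 2 =
      x ^ 2 * (∫ p, u p ^ 2) + 2 * x * y * (∫ p, u p * v p) + y ^ 2 * ∫ p, v p ^ 2 := by
    intro x y
    have h : ∀ p, (x • u + y • v) p ^ 2 =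
        x ^ 2 * u p ^ 2 + 2 * x * y * (u p * v p) + y ^ 2 * v p ^ 2 := by
      intro p
      simp only [Pi.add_apply, Pi.smul_apply, smul_eq_mul]
      ring
    simp only [h]
    have hi : Integrable fun p => x ^ 2 * u p ^ 2 + 2 * x * y * (u p * v p) :=
      (hiu.const_mul _).add (hiuv.const_mul _)
    rw [integral_add hi (hiv.const_mul _),
      integral_add (hiu.const_mul _) (hiuv.const_mul _), integral_const_mul, integral_const_mul,
      integral_const_mul]
  have hDpos : ∀ x y : ℝ, x ≠ 0 ∨ y ≠ 0 →
      0 < x ^ 2 * (∫ p, u p ^ 2) + 2 * x * y * (∫ p, u p * v p) + y ^ 2 * ∫ p, v p ^ 2 := by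
    intro x y hxy
    rw [← hD]
    have hw := hV (V.add_mem (V.smul_mem x (b 0).2) (V.smul_mem y (b 1).2))
    exact integral_sq_pos hw.1.continuous hw.2.1 (hne x y hxy)
  have hN : ∀ x y : ℝ, ∫ p, gradSq (x • u + y • v) p ≤
      2 * x ^ 2 * (∫ p, gradSq u p) + 2 * y ^ 2 * ∫ p, gradSq v p := by
    intro x y
    have hw : testFun ω (x • u + y • v) :=
      hV (V.add_mem (V.smul_mem x (b 0).2) (V.smul_mem y (b 1).2))
    have h1 := integrable_gradSq hu.contDiff_one hu.2.1
    have h2 := integrable_gradSq hv.contDiff_one hv.2.1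
    rw [← integral_const_mul, ← integral_const_mul,
      ← integral_add (h1.const_mul _) (h2.const_mul _)]
    exact integral_mono (integrable_gradSq hw.contDiff_one hw.2.1)
      ((h1.const_mul _).add (h2.const_mul _))
      (gradSq_linearCombination_le hu.contDiff_one hv.contDiff_one x y)
  have hA : 0 ≤ ∫ p, gradSq u p := integral_nonneg (gradSq_nonneg u)
  have hB : 0 ≤ ∫ p, gradSq v p := integral_nonneg (gradSq_nonneg v)
  generalize (∫ p, gradSq u p) = A at hN hA
  generalize (∫ p, gradSq v p) = B at hN hB
  generalize (∫ p, u p ^ 2) = α at hD hDpos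
  generalize (∫ p, v p ^ 2) = γ at hD hDpos
  generalize (∫ p, u p * v p) = β at hD hDpos
  have hα : 0 < α := by simpa using hDpos 1 0 (by simp)
  have hγ : 0 < γ := by simpa using hDpos 0 1 (by simp)
  have hdet : 0 < α * γ - β ^ 2 := by
    have h := hDpos (-β) α (Or.inr hα.ne')
    have h2 : 0 < α * (α * γ - β ^ 2) := by linarith
    exact pos_of_mul_pos_right h2 hα.le
  refine ⟨2 * (A + B) * (α + γ) / (α * γ - β ^ 2), ?_⟩
  rintro r ⟨w, hw, hw0, rfl⟩
  rw [rayleigh_eq_of_testFun (hV hw)]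
  obtain ⟨x, y, rfl⟩ := hrep w hw
  have hxy : x ≠ 0 ∨ y ≠ 0 := by
    by_contra! h
    exact hw0 (by simp [h.1, h.2])
  rw [hD, div_le_div_iff₀ (hDpos x y hxy) hdet]
  have hlow : (α * γ - β ^ 2) * (x ^ 2 + y ^ 2) ≤
      (α + γ) * (x ^ 2 * α + 2 * x * y * β + y ^ 2 * γ) := by
    nlinarith [sq_nonneg (α * x + β * y), sq_nonneg (β * x + γ * y)]
  have hup : ∫ p, gradSq (x • u + y • v) p ≤ 2 * (A + B) * (x ^ 2 + y ^ 2) := by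
    refine (hN x y).trans ?_
    nlinarith [mul_nonneg hA (sq_nonneg y), mul_nonneg hB (sq_nonneg x)]
  calc (∫ p, gradSq (x • u + y • v) p) * (α * γ - β ^ 2)
      ≤ 2 * (A + B) * (x ^ 2 + y ^ 2) * (α * γ - β ^ 2) := by gcongr
    _ = 2 * (A + B) * ((α * γ - β ^ 2) * (x ^ 2 + y ^ 2)) := by ring
    _ ≤ 2 * (A + B) * ((α + γ) * (x ^ 2 * α + 2 * x * y * β + y ^ 2 * γ)) := by gcongr
    _ = _ := by ring

theorem exists_norm_bounds_of_testFun_halfDisk {R : ℝ} (hR : 0 < R) {u : ℝ × ℝ → ℝ}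
    (hu : testFun (halfDisk R) u) (hu0 : u ≠ 0) :
    ∃ ρ b, 0 < ρ ∧ ρ ≤ b ∧ b < R ∧
      ∀ x ∈ tsupport u, ρ ^ 2 < x.1 ^ 2 + x.2 ^ 2 ∧ x.1 ^ 2 + x.2 ^ 2 < b ^ 2 := by
  have hne : (tsupport u).Nonempty := by
    rw [nonempty_iff_ne_empty, Ne, tsupport_eq_empty_iff]
    exact hu0
  have hf : ContinuousOn (fun x : ℝ × ℝ => x.1 ^ 2 + x.2 ^ 2) (tsupport u) :=
    Continuous.continuousOn (by fun_prop)
  have hK : IsCompact (tsupport u) := hu.2.1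
  obtain ⟨p, hp, hmin⟩ := hK.exists_isMinOn hne hf
  obtain ⟨q, hq, hmax⟩ := hK.exists_isMaxOn hne hf
  have hp' := hu.2.2 hp
  have hq' := hu.2.2 hq
  have hp2 : 0 < p.2 := hp'.2
  have hqR : q.1 ^ 2 + q.2 ^ 2 < R ^ 2 := hq'.1
  have hppos : 0 < p.1 ^ 2 + p.2 ^ 2 := by positivity
  have hpq : p.1 ^ 2 + p.2 ^ 2 ≤ q.1 ^ 2 + q.2 ^ 2 := hmin hq
  refine ⟨√((p.1 ^ 2 + p.2 ^ 2) / 2), √((q.1 ^ 2 + q.2 ^ 2 + R ^ 2) / 2), by positivity,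
    Real.sqrt_le_sqrt (by linarith), (Real.sqrt_lt' hR).2 (by linarith), fun x hx => ?_⟩
  rw [Real.sq_sqrt (by positivity), Real.sq_sqrt (by positivity)]
  have h1 : p.1 ^ 2 + p.2 ^ 2 ≤ x.1 ^ 2 + x.2 ^ 2 := hmin hx
  have h2 : x.1 ^ 2 + x.2 ^ 2 ≤ q.1 ^ 2 + q.2 ^ 2 := hmax hx
  constructor <;> linarith

/-- The value at radius `r` of the first sine coefficient of the odd reflection of `u`. -/
def oddSineCoeff (ω : Set (ℝ × ℝ)) (V : Submodule ℝ ((ℝ × ℝ) → ℝ))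
    (hV : (V : Set ((ℝ × ℝ) → ℝ)) ⊆ {u | testFun ω u}) (r : ℝ) : V →ₗ[ℝ] ℝ where
  toFun u := ∫ θ in (-π)..π, (1 * u.1 (r * Real.cos θ, r * Real.sin θ) +
    -1 * u.1 (1 * (r * Real.cos θ), -1 * (r * Real.sin θ))) * Real.sin θ
  map_add' u v := by
    have hu : Continuous u.1 := (hV u.2).1.continuous
    have hv : Continuous v.1 := (hV v.2).1.continuous
    rw [← intervalIntegral.integral_add (Continuous.intervalIntegrable (by fun_prop) _ _)
      (Continuous.intervalIntegrable (by fun_prop) _ _)]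
    refine intervalIntegral.integral_congr fun θ _ => ?_
    simp only [Submodule.coe_add, Pi.add_apply]
    ring
  map_smul' c u := by
    simp only [RingHom.id_apply, smul_eq_mul]
    rw [← intervalIntegral.integral_const_mul]
    refine intervalIntegral.integral_congr fun θ _ => ?_
    simp only [Submodule.coe_smul, Pi.smul_apply, smul_eq_mul]
    ring

theorem le_dirichletEV_halfDisk {c R s₀ : ℝ} (hc : 0 < c) (hR : 0 < R) (hcR : c * R ^ 2 = s₀)
    (hs₀ : ∀ s ∈ Ico 0 s₀, 0 < besselSeries 2 s)
    (hne : ∃ V : Submodule ℝ ((ℝ × ℝ) → ℝ),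
      (V : Set ((ℝ × ℝ) → ℝ)) ⊆ {u | testFun (halfDisk R) u} ∧ Module.finrank ℝ V = 2) :
    4 * c ≤ dirichletEV (halfDisk R) 2 := by
  obtain ⟨V₀, hV₀, hk₀⟩ := hne
  refine le_csInf ⟨_, V₀, hV₀, hk₀, rfl⟩ ?_
  rintro l ⟨V, hV, hk, rfl⟩
  obtain ⟨r₀, -, hr₀⟩ := exists_radial_inequality_one hc hR hcR hs₀
  have : Module.Finite ℝ V := Module.finite_of_finrank_pos (by omega)
  obtain ⟨w, hw, hw0⟩ := Submodule.exists_mem_ne_zero_of_ne_bot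
    (LinearMap.ker_ne_bot_of_finrank_lt (f := oddSineCoeff _ V hV r₀) (by simp [hk]))
  obtain ⟨u, huV⟩ := w
  have hconstr : ∫ θ in (-π)..π, (1 * u (r₀ * Real.cos θ, r₀ * Real.sin θ) +
    -1 * u (1 * (r₀ * Real.cos θ), -1 * (r₀ * Real.sin θ))) * Real.sin θ = 0 := hw
  have hu0 : u ≠ 0 := fun h => hw0 (Subtype.ext h)
  have hu : testFun (halfDisk R) u := hV huV
  refine le_trans ?_ (le_csSup (bddAbove_rayleigh hV hk) ⟨u, huV, hu0, rfl⟩)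
  rw [rayleigh_eq_of_testFun hu, le_div_iff₀ (integral_sq_pos hu.1.continuous hu.2.1 hu0)]
  obtain ⟨ρ, b, hρ, hρb, hbR, hsupp⟩ := exists_norm_bounds_of_testFun_halfDisk hR hu hu0
  have hdis : ∀ x ∈ tsupport u, ((1 * x.1, -1 * x.2) : ℝ × ℝ) ∉ tsupport u := by
    intro x hx hx'
    have h1 : 0 < x.2 := (hu.2.2 hx).2
    have h2 : 0 < -1 * x.2 := (hu.2.2 hx').2
    linarith
  have hU1 := hu.contDiff_one
  have hzero : ∀ x : ℝ × ℝ, x.1 ^ 2 + x.2 ^ 2 ≤ ρ ^ 2 ∨ b ^ 2 ≤ x.1 ^ 2 + x.2 ^ 2 →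
      1 * u x + -1 * u (1 * x.1, -1 * x.2) = 0 := by
    have key : ∀ x : ℝ × ℝ, x.1 ^ 2 + x.2 ^ 2 ≤ ρ ^ 2 ∨ b ^ 2 ≤ x.1 ^ 2 + x.2 ^ 2 → u x = 0 := by
      intro x hx
      refine image_eq_zero_of_notMem_tsupport fun h => ?_
      have := hsupp x h
      rcases hx with hx | hx <;> linarith
    intro x hx
    rw [key x hx, key (1 * x.1, -1 * x.2) (by simpa using hx)]
    norm_num
  have h := mul_integral_sq_le_of_odd hc hcR hs₀ hr₀
    (U := fun x => 1 * u x + -1 * u (1 * x.1, -1 * x.2)) (by fun_prop)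
    (fun x y => by simp only [one_mul, neg_mul, neg_neg]; ring) hρ hρb hbR
    (fun x hx => hzero x (Or.inl hx)) (fun x hx => hzero x (Or.inr hx)) hconstr
  rw [integral_gradSq_add_reflection (by norm_num) (by norm_num) hU1 hu.2.1 hdis,
    integral_sq_add_reflection (by norm_num) (by norm_num) hU1.continuous hu.2.1 hdis] at h
  linarith

theorem deriv_smoothTransition_eq_zero {s : ℝ} (hs : s < 0 ∨ 1 < s) :
    deriv smoothTransition s = 0 := by
  rcases hs with hs | hs
  · have : smoothTransition =ᶠ[nhds s] fun _ => 0 := by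
      filter_upwards [Iio_mem_nhds hs] with y hy using smoothTransition.zero_of_nonpos hy.le
    simp [this.deriv_eq]
  · have : smoothTransition =ᶠ[nhds s] fun _ => 1 := by
      filter_upwards [Ioi_mem_nhds hs] with y hy using smoothTransition.one_of_one_le hy.le
    simp [this.deriv_eq]

theorem exists_abs_deriv_smoothTransition_le :
    ∃ M : ℝ, 0 ≤ M ∧ ∀ s, |deriv smoothTransition s| ≤ M := by
  have hc : Continuous (deriv smoothTransition) :=
    (smoothTransition.contDiff (n := 1)).continuous_deriv le_rfl
  have hs : HasCompactSupport (deriv smoothTransition) := by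
    refine HasCompactSupport.intro (isCompact_Icc (a := (0 : ℝ)) (b := 1)) fun x hx => ?_
    rw [mem_Icc, not_and_or, not_le, not_le] at hx
    exact deriv_smoothTransition_eq_zero hx
  obtain ⟨M, hM⟩ := hs.exists_bound_of_continuous hc
  exact ⟨M, (norm_nonneg _).trans (hM 0), hM⟩

theorem gradSq_mul_le {χ η : ℝ × ℝ → ℝ} (hχ : ContDiff ℝ 1 χ) (hη : ContDiff ℝ 1 η)
    (hχ1 : ∀ x, χ x ^ 2 ≤ 1) (x : ℝ × ℝ) :
    gradSq (fun x => χ x * η x) x ≤ 2 * η x ^ 2 * gradSq χ x + 2 * gradSq η x := by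
  have h := ((hχ.differentiable one_ne_zero x).hasFDerivAt.mul
    (hη.differentiable one_ne_zero x).hasFDerivAt).fderiv
  change fderiv ℝ (fun x => χ x * η x) x = _ at h
  unfold gradSq
  rw [h]
  simp only [add_apply, smul_apply, smul_eq_mul]
  have h1 := hχ1 x
  generalize χ x = a at *
  generalize η x = b at *
  generalize fderiv ℝ χ x (1, 0) = A
  generalize fderiv ℝ χ x (0, 1) = A'
  generalize fderiv ℝ η x (1, 0) = B
  generalize fderiv ℝ η x (0, 1) = B'
  nlinarith [sq_nonneg (a * B - b * A), sq_nonneg (a * B' - b * A'),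
    mul_nonneg (sub_nonneg.2 h1) (sq_nonneg B), mul_nonneg (sub_nonneg.2 h1) (sq_nonneg B')]

theorem gradSq_comp {f : ℝ → ℝ} {u : ℝ × ℝ → ℝ} (hf : ContDiff ℝ 1 f) (hu : ContDiff ℝ 1 u)
    (x : ℝ × ℝ) : gradSq (fun x => f (u x)) x = deriv f (u x) ^ 2 * gradSq u x := by
  have h := ((hf.differentiable one_ne_zero (u x)).hasDerivAt.comp_hasFDerivAt x
    (hu.differentiable one_ne_zero x).hasFDerivAt).fderiv
  change fderiv ℝ (fun x => f (u x)) x = _ at h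
  unfold gradSq
  rw [h]
  simp only [smul_apply, smul_eq_mul]
  ring

/-- Localization formula: the energy of `χ φ` for an eigenfunction `φ` and a cutoff `χ`. -/
theorem integral_gradSq_mul_eigenfunction {φ p q χ : ℝ × ℝ → ℝ} {lam : ℝ} (hφ : ContDiff ℝ 1 φ)
    (hp : ContDiff ℝ 1 p) (hq : ContDiff ℝ 1 q) (hφp : ∀ x, fderiv ℝ φ x (1, 0) = p x)
    (hφq : ∀ x, fderiv ℝ φ x (0, 1) = q x)
    (hlap : ∀ x, fderiv ℝ p x (1, 0) + fderiv ℝ q x (0, 1) = -lam * φ x)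
    (hχ : ContDiff ℝ 1 χ) (hc : HasCompactSupport χ) :
    ∫ x, gradSq (fun x => χ x * φ x) x =
      lam * (∫ x, (χ x * φ x) ^ 2) + ∫ x, φ x ^ 2 * gradSq χ x := by
  set g : ℝ × ℝ → ℝ := fun x => χ x ^ 2 * φ x with hg_def
  have hg : ContDiff ℝ 1 g := by fun_prop
  have hgs : HasCompactSupport g := HasCompactSupport.intro hc fun x hx => by
    simp only [hg_def]
    rw [image_eq_zero_of_notMem_tsupport hx]
    ring
  have hφc := hφ.continuous
  have hpc := hp.continuous
  have hqc := hq.continuous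
  have hχc := hχ.continuous
  have hgc := hg.continuous
  have hdg := hg.continuous_fderiv one_ne_zero
  have hdp := hp.continuous_fderiv one_ne_zero
  have hdq := hq.continuous_fderiv one_ne_zero
  have hint : ∀ F : ℝ × ℝ → ℝ, Continuous F → (∀ x, x ∉ tsupport g → F x = 0) → Integrable F :=
    fun F hF h => hF.integrable_of_hasCompactSupport (HasCompactSupport.intro hgs h)
  have hg0 : ∀ x, x ∉ tsupport g → g x = 0 := fun x hx => image_eq_zero_of_notMem_tsupport hx
  have hfg0 : ∀ x, x ∉ tsupport g → fderiv ℝ g x = 0 := fun x hx =>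
    fderiv_of_notMem_tsupport (𝕜 := ℝ) hx
  have hib : ∀ (r : ℝ × ℝ → ℝ) (v : ℝ × ℝ), ContDiff ℝ 1 r →
      Integrable (fun x => r x * fderiv ℝ g x v) ∧ Integrable (fun x => fderiv ℝ r x v * g x) ∧
      ∫ x, r x * fderiv ℝ g x v = -∫ x, fderiv ℝ r x v * g x := by
    intro r v hr
    have hrc := hr.continuous
    have hdr := hr.continuous_fderiv one_ne_zero
    have h1 : Integrable (fun x => r x * fderiv ℝ g x v) :=
      hint _ (by fun_prop) fun x hx => by rw [hfg0 x hx]; simp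
    have h2 : Integrable (fun x => fderiv ℝ r x v * g x) :=
      hint _ (by fun_prop) fun x hx => by rw [hg0 x hx, mul_zero]
    have h3 : Integrable (fun x => r x * g x) :=
      hint _ (by fun_prop) fun x hx => by rw [hg0 x hx, mul_zero]
    exact ⟨h1, h2, integral_mul_fderiv_eq_neg_fderiv_mul_of_integrable h2 h1 h3
      (fun x _ => hr.differentiable one_ne_zero x) (fun x _ => hg.differentiable one_ne_zero x)⟩
  obtain ⟨i1, j1, e1⟩ := hib p (1, 0) hp
  obtain ⟨i2, j2, e2⟩ := hib q (0, 1) hq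
  have i3 : Integrable fun x => φ x ^ 2 * gradSq χ x := by
    have := continuous_gradSq hχ
    refine Continuous.integrable_of_hasCompactSupport (by fun_prop)
      (HasCompactSupport.intro hc fun x hx => ?_)
    rw [gradSq_eq_zero_of_notMem_tsupport hx, mul_zero]
  have hpt : ∀ x, gradSq (fun x => χ x * φ x) x =
      p x * fderiv ℝ g x (1, 0) + q x * fderiv ℝ g x (0, 1) + φ x ^ 2 * gradSq χ x := by
    intro x
    have dχ := (hχ.differentiable one_ne_zero x).hasFDerivAt
    have dφ := (hφ.differentiable one_ne_zero x).hasFDerivAt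
    have h1 := (dχ.mul dφ).fderiv
    change fderiv ℝ (fun x => χ x * φ x) x = _ at h1
    have h2 := ((dχ.mul dχ).mul dφ).fderiv
    have hgx : g = fun x => χ x * χ x * φ x := by
      ext x
      simp only [hg_def]
      ring
    change fderiv ℝ (fun x => χ x * χ x * φ x) x = _ at h2
    rw [← hgx] at h2
    unfold gradSq
    rw [h1, h2]
    simp only [add_apply, smul_apply, smul_eq_mul, hφp, hφq, Pi.mul_apply]
    ring
  have i12 : Integrable fun x => p x * fderiv ℝ g x (1, 0) + q x * fderiv ℝ g x (0, 1) := i1.add i2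
  simp only [hpt]
  rw [integral_add i12 i3, integral_add i1 i2, e1, e2, ← neg_add, ← integral_add j1 j2,
    ← integral_neg, ← integral_const_mul]
  congr 1
  refine integral_congr_ae (Filter.Eventually.of_forall fun x => ?_)
  simp only [hg_def]
  linear_combination (-(χ x ^ 2 * φ x)) * hlap x

/-- The separated eigenfunction `x₁ x₂ J₂(2√c |x|) / |x|²` of the quarter disk, up to a factor. -/
def quarterEigenfunction (c : ℝ) (x : ℝ × ℝ) : ℝ :=
  x.1 * x.2 * besselSeries 2 (c * (x.1 ^ 2 + x.2 ^ 2))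

theorem contDiff_quarterEigenfunction (c : ℝ) :
    ContDiff ℝ (⊤ : ℕ∞) (quarterEigenfunction c) := by
  have := contDiff_besselSeries 2
  unfold quarterEigenfunction
  fun_prop

theorem integral_gradSq_mul_quarterEigenfunction (c : ℝ) {χ : ℝ × ℝ → ℝ} (hχ : ContDiff ℝ 1 χ)
    (hc : HasCompactSupport χ) :
    ∫ x, gradSq (fun x => χ x * quarterEigenfunction c x) x =
      4 * c * (∫ x, (χ x * quarterEigenfunction c x) ^ 2) +
        ∫ x, quarterEigenfunction c x ^ 2 * gradSq χ x := by
  have hB : ∀ m, ContDiff ℝ 1 (besselSeries m) := fun m =>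
    (contDiff_besselSeries m).of_le (by exact_mod_cast le_top)
  have hB2 := hB 2
  have hB3 := hB 3
  have hd : ∀ m (x : ℝ × ℝ), HasFDerivAt (fun x : ℝ × ℝ => besselSeries m (c * (x.1 ^ 2 + x.2 ^ 2)))
      ((-besselSeries (m + 1) (c * (x.1 ^ 2 + x.2 ^ 2))) • (c • ((2 * x.1) •
        ContinuousLinearMap.fst ℝ ℝ ℝ + (2 * x.2) • ContinuousLinearMap.snd ℝ ℝ ℝ))) x := by
    intro m x
    have h1 : HasFDerivAt (fun x : ℝ × ℝ => c * (x.1 ^ 2 + x.2 ^ 2)) (c • ((2 * x.1) •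
        ContinuousLinearMap.fst ℝ ℝ ℝ + (2 * x.2) • ContinuousLinearMap.snd ℝ ℝ ℝ)) x := by
      refine (((hasFDerivAt_fst.pow 2).add (hasFDerivAt_snd.pow 2)).const_mul c).congr_fderiv ?_
      simp
    exact (hasDerivAt_besselSeries m _).comp_hasFDerivAt x h1
  have hd1 : ∀ x : ℝ × ℝ, HasFDerivAt (fun x : ℝ × ℝ => x.1) (ContinuousLinearMap.fst ℝ ℝ ℝ) x :=
    fun x => hasFDerivAt_fst
  have hd2 : ∀ x : ℝ × ℝ, HasFDerivAt (fun x : ℝ × ℝ => x.2) (ContinuousLinearMap.snd ℝ ℝ ℝ) x :=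
    fun x => hasFDerivAt_snd
  set p : ℝ × ℝ → ℝ := fun x => x.2 * besselSeries 2 (c * (x.1 ^ 2 + x.2 ^ 2)) -
    2 * c * ((x.1 * x.1 * x.2) * besselSeries 3 (c * (x.1 ^ 2 + x.2 ^ 2))) with hp
  set q : ℝ × ℝ → ℝ := fun x => x.1 * besselSeries 2 (c * (x.1 ^ 2 + x.2 ^ 2)) -
    2 * c * ((x.1 * x.2 * x.2) * besselSeries 3 (c * (x.1 ^ 2 + x.2 ^ 2))) with hq
  have hφd : ∀ x, HasFDerivAt (quarterEigenfunction c) _ x := fun x =>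
    ((hd1 x).mul (hd2 x)).mul (hd 2 x)
  have hpd : ∀ x, HasFDerivAt p _ x := fun x => ((hd2 x).mul (hd 2 x)).sub
    (((((hd1 x).mul (hd1 x)).mul (hd2 x)).mul (hd 3 x)).const_mul (2 * c))
  have hqd : ∀ x, HasFDerivAt q _ x := fun x => ((hd1 x).mul (hd 2 x)).sub
    (((((hd1 x).mul (hd2 x)).mul (hd2 x)).mul (hd 3 x)).const_mul (2 * c))
  refine integral_gradSq_mul_eigenfunction (p := p) (q := q)
    ((contDiff_quarterEigenfunction c).of_le (by exact_mod_cast le_top)) (by fun_prop)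
    (by fun_prop) (fun x => ?_) (fun x => ?_) (fun x => ?_) hχ hc
  · rw [(hφd x).fderiv]
    simp [hp]
    ring
  · rw [(hφd x).fderiv]
    simp [hq]
    ring
  · rw [(hpd x).fderiv, (hqd x).fderiv]
    simp [quarterEigenfunction]
    linear_combination (4 * c * x.1 * x.2) * besselSeries_recurrence 2 (c * (x.1 ^ 2 + x.2 ^ 2))

theorem dirichletEV_two_le_of_reflection {ω : Set (ℝ × ℝ)} (hω : ∀ x ∈ ω, (-x.1, x.2) ∈ ω)
    {ψ : ℝ × ℝ → ℝ} (hψ : testFun (ω ∩ {x | 0 < x.1}) ψ) (hψ0 : ψ ≠ 0) :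
    (∃ V : Submodule ℝ ((ℝ × ℝ) → ℝ),
      (V : Set ((ℝ × ℝ) → ℝ)) ⊆ {u | testFun ω u} ∧ Module.finrank ℝ V = 2) ∧
    dirichletEV ω 2 ≤ (∫ x, gradSq ψ x) / ∫ x, ψ x ^ 2 := by
  set ψ' : ℝ × ℝ → ℝ := fun x => ψ (-1 * x.1, 1 * x.2) with hψ'
  have hdis : ∀ x ∈ tsupport ψ, ((-1 * x.1, 1 * x.2) : ℝ × ℝ) ∉ tsupport ψ := by
    intro x hx hx'
    have h1 : 0 < x.1 := (hψ.2.2 hx).2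
    have h2 : 0 < -1 * x.1 := (hψ.2.2 hx').2
    linarith
  have hψ1 := hψ.contDiff_one
  have hψs := hψ.1
  have hsmooth : ContDiff ℝ (⊤ : ℕ∞) ψ' := by fun_prop
  set K : Set (ℝ × ℝ) := (fun x : ℝ × ℝ => (-1 * x.1, 1 * x.2)) '' tsupport ψ with hK
  have hKc : IsCompact K := IsCompact.image hψ.2.1 (by fun_prop)
  have hzero : ∀ x, x ∉ K → ψ' x = 0 := fun x hx =>
    image_eq_zero_of_notMem_tsupport (f := ψ) fun h => hx ⟨_, h, by ext <;> simp⟩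
  have hsub : tsupport ψ' ⊆ K :=
    closure_minimal (fun x hx => by_contra fun h => hx (hzero x h)) hKc.isClosed
  have htest : ∀ α β : ℝ, testFun ω (α • ψ + β • ψ') := by
    intro α β
    have h0 : ∀ x, x ∉ tsupport ψ ∪ K → (α • ψ + β • ψ') x = 0 := by
      intro x hx
      rw [mem_union, not_or] at hx
      simp [image_eq_zero_of_notMem_tsupport hx.1, hzero x hx.2]
    have hcl : IsCompact (tsupport ψ ∪ K) := IsCompact.union hψ.2.1 hKc
    refine ⟨(contDiff_const.smul hψ.1).add (contDiff_const.smul hsmooth),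
      HasCompactSupport.intro hcl h0, Subset.trans
        (closure_minimal (fun x hx => by_contra fun h => hx (h0 x h)) hcl.isClosed) ?_⟩
    rintro x (hx | ⟨y, hy, rfl⟩)
    · exact (hψ.2.2 hx).1
    · simpa using hω y (hψ.2.2 hy).1
  obtain ⟨p, hp⟩ := Function.ne_iff.1 hψ0
  have hpt : p ∈ tsupport ψ := subset_tsupport ψ hp
  have hp' : ψ' p = 0 := image_eq_zero_of_notMem_tsupport (f := ψ) (hdis p hpt)
  have hlin : LinearIndependent ℝ ![ψ, ψ'] := by
    rw [LinearIndependent.pair_iff]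
    intro s t hst
    have h1 := congrFun hst p
    have h2 := congrFun hst (-1 * p.1, 1 * p.2)
    have h3 : ψ (-1 * p.1, 1 * p.2) = 0 := hp'
    simp only [Pi.add_apply, Pi.smul_apply, smul_eq_mul, hp', Pi.zero_apply, mul_zero,
      add_zero] at h1
    simp only [Pi.add_apply, Pi.smul_apply, smul_eq_mul, Pi.zero_apply, h3, hψ', mul_zero,
      zero_add] at h2
    norm_num at h2
    exact ⟨(mul_eq_zero.1 h1).resolve_right hp, h2.resolve_right hp⟩
  have hV : ((Submodule.span ℝ (range ![ψ, ψ']) : Submodule ℝ ((ℝ × ℝ) → ℝ)) :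
      Set ((ℝ × ℝ) → ℝ)) ⊆ {u | testFun ω u} := by
    intro u hu
    rw [SetLike.mem_coe, Matrix.range_cons, Matrix.range_cons, Matrix.range_empty, union_empty,
      singleton_union, Submodule.mem_span_pair] at hu
    obtain ⟨α, β, rfl⟩ := hu
    exact htest α β
  have hk : Module.finrank ℝ (Submodule.span ℝ (range ![ψ, ψ'])) = 2 := by
    rw [finrank_span_eq_card hlin, Fintype.card_fin]
  refine ⟨⟨_, hV, hk⟩, (csInf_le (bddBelow_dirichletEV_set ω 2) ⟨_, hV, hk, rfl⟩).trans ?_⟩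
  refine Real.sSup_le ?_ (div_nonneg (integral_nonneg fun x => gradSq_nonneg ψ x)
    (integral_nonneg fun _ => sq_nonneg _))
  rintro r ⟨u, hu, hu0, rfl⟩
  rw [rayleigh_eq_of_testFun (hV hu)]
  rw [Matrix.range_cons, Matrix.range_cons, Matrix.range_empty, union_empty,
    singleton_union, Submodule.mem_span_pair] at hu
  obtain ⟨α, β, rfl⟩ := hu
  have hαβ : α ^ 2 + β ^ 2 ≠ 0 := by
    intro h
    have h1 : α = 0 := by nlinarith
    have h2 : β = 0 := by nlinarith
    exact hu0 (by simp [h1, h2])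
  have e1 := integral_gradSq_add_reflection (s := -1) (t := 1) (by norm_num) (by norm_num) hψ1
    hψ.2.1 hdis α β
  have e2 := integral_sq_add_reflection (s := -1) (t := 1) (by norm_num) (by norm_num)
    hψ1.continuous hψ.2.1 hdis α β
  change (∫ x, gradSq (fun x => α * ψ x + β * ψ (-1 * x.1, 1 * x.2)) x) /
    (∫ x : ℝ × ℝ, (α * ψ x + β * ψ (-1 * x.1, 1 * x.2)) ^ 2) ≤ _
  rw [e1, e2, mul_div_mul_left _ _ hαβ]

/-- The open quarter disk. -/
def quarterDisk (R : ℝ) : Set (ℝ × ℝ) := {x | x.1 ^ 2 + x.2 ^ 2 < R ^ 2 ∧ 0 < x.1 ∧ 0 < x.2}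

/-- The closed quarter disk. -/
def closedQuarterDisk (R : ℝ) : Set (ℝ × ℝ) := {x | x.1 ^ 2 + x.2 ^ 2 ≤ R ^ 2 ∧ 0 ≤ x.1 ∧ 0 ≤ x.2}

theorem isOpen_quarterDisk (R : ℝ) : IsOpen (quarterDisk R) :=
  (isOpen_lt (by fun_prop : Continuous fun x : ℝ × ℝ => x.1 ^ 2 + x.2 ^ 2) continuous_const).and
    ((isOpen_lt continuous_const continuous_fst).and (isOpen_lt continuous_const continuous_snd))

theorem isCompact_closedQuarterDisk {R : ℝ} (hR : 0 < R) : IsCompact (closedQuarterDisk R) := by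
  have hcl : IsClosed (closedQuarterDisk R) :=
    (isClosed_le (by fun_prop : Continuous fun x : ℝ × ℝ => x.1 ^ 2 + x.2 ^ 2)
      continuous_const).and ((isClosed_le continuous_const continuous_fst).and
        (isClosed_le continuous_const continuous_snd))
  refine (isCompact_Icc.prod isCompact_Icc : IsCompact (Icc 0 R ×ˢ Icc 0 R)).of_isClosed_subset
    hcl ?_
  rintro x ⟨h, h1, h2⟩
  exact ⟨⟨h1, by nlinarith⟩, ⟨h2, by nlinarith⟩⟩

theorem quarterDisk_subset_closedQuarterDisk (R : ℝ) : quarterDisk R ⊆ closedQuarterDisk R :=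
  fun _ h => ⟨h.1.le, h.2.1.le, h.2.2.le⟩

theorem quarterEigenfunction_pos {c R s₀ : ℝ} (hc : 0 < c) (hcR : c * R ^ 2 = s₀)
    (hs₀ : ∀ s ∈ Ico 0 s₀, 0 < besselSeries 2 s) {x : ℝ × ℝ} (hx : x ∈ quarterDisk R) :
    0 < quarterEigenfunction c x := by
  obtain ⟨h, h1, h2⟩ := hx
  refine mul_pos (mul_pos h1 h2) (hs₀ _ ⟨by positivity, ?_⟩)
  rw [← hcR]
  gcongr

theorem quarterEigenfunction_eq_zero {c R s₀ : ℝ} (hcR : c * R ^ 2 = s₀)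
    (h₀ : besselSeries 2 s₀ = 0) {x : ℝ × ℝ} (hx : x ∈ closedQuarterDisk R)
    (hx' : x ∉ quarterDisk R) : quarterEigenfunction c x = 0 := by
  unfold quarterEigenfunction
  obtain ⟨h, h1, h2⟩ := hx
  rcases h1.eq_or_lt with h1 | h1
  · rw [← h1, zero_mul, zero_mul]
  rcases h2.eq_or_lt with h2 | h2
  · rw [← h2, mul_zero, zero_mul]
  have h3 : x.1 ^ 2 + x.2 ^ 2 = R ^ 2 := le_antisymm h (not_lt.1 fun h => hx' ⟨h, h1, h2⟩)
  rw [h3, hcR, h₀, mul_zero]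

/-- A cutoff function of the quarter disk, equal to one where the eigenfunction is large. -/
def eigenCutoff (c R ε : ℝ) : ℝ × ℝ → ℝ :=
  (quarterDisk R).indicator fun x => smoothTransition (quarterEigenfunction c x / ε - 1)

theorem tsupport_eigenCutoff_subset {c R s₀ : ℝ} (hR : 0 < R) (hcR : c * R ^ 2 = s₀)
    (h₀ : besselSeries 2 s₀ = 0) {ε : ℝ} (hε : 0 < ε) :
    IsCompact (closedQuarterDisk R ∩ {x | ε ≤ quarterEigenfunction c x}) ∧
    closedQuarterDisk R ∩ {x | ε ≤ quarterEigenfunction c x} ⊆ quarterDisk R ∧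
    tsupport (eigenCutoff c R ε) ⊆ closedQuarterDisk R ∩ {x | ε ≤ quarterEigenfunction c x} := by
  have hcpt : IsCompact (closedQuarterDisk R ∩ {x | ε ≤ quarterEigenfunction c x}) :=
    (isCompact_closedQuarterDisk hR).inter_right
      (isClosed_le continuous_const (contDiff_quarterEigenfunction c).continuous)
  refine ⟨hcpt, ?_, closure_minimal ?_ hcpt.isClosed⟩
  · rintro x ⟨hx, hxε⟩
    by_contra h
    have hxε' : ε ≤ quarterEigenfunction c x := hxε
    rw [quarterEigenfunction_eq_zero hcR h₀ hx h] at hxε'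
    linarith
  · intro x hx
    have hxQ : x ∈ quarterDisk R := by
      by_contra h
      exact hx (indicator_of_notMem h _)
    refine ⟨quarterDisk_subset_closedQuarterDisk R hxQ, ?_⟩
    by_contra h
    refine hx ?_
    rw [eigenCutoff, indicator_of_mem hxQ]
    refine smoothTransition.zero_of_nonpos ?_
    rw [mem_ofPred_eq, not_le] at h
    rw [sub_nonpos, div_le_one hε]
    exact h.le

theorem contDiff_eigenCutoff {c R s₀ : ℝ} (hR : 0 < R) (hcR : c * R ^ 2 = s₀)
    (h₀ : besselSeries 2 s₀ = 0) {ε : ℝ} (hε : 0 < ε) :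
    ContDiff ℝ (⊤ : ℕ∞) (eigenCutoff c R ε) := by
  obtain ⟨-, hsub, hts⟩ := tsupport_eigenCutoff_subset hR hcR h₀ hε
  refine contDiff_iff_contDiffAt.2 fun x => ?_
  by_cases hx : x ∈ quarterDisk R
  · have h1 : ContDiff ℝ (⊤ : ℕ∞) fun x => smoothTransition (quarterEigenfunction c x / ε - 1) := by
      have := contDiff_quarterEigenfunction c
      exact smoothTransition.contDiff.comp (by fun_prop)
    refine h1.contDiffAt.congr_of_eventuallyEq ?_
    filter_upwards [(isOpen_quarterDisk R).mem_nhds hx] with y hy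
    exact indicator_of_mem hy _
  · have h1 : eigenCutoff c R ε =ᶠ[nhds x] fun _ => 0 := by
      filter_upwards [(isClosed_tsupport (eigenCutoff c R ε)).isOpen_compl.mem_nhds
        fun h => hx (hsub (hts h))] with y hy
      exact image_eq_zero_of_notMem_tsupport hy
    exact contDiffAt_const.congr_of_eventuallyEq h1

theorem gradSq_congr_of_eventuallyEq {u v : ℝ × ℝ → ℝ} {x : ℝ × ℝ} (h : u =ᶠ[nhds x] v) :
    gradSq u x = gradSq v x := by
  unfold gradSq
  rw [h.fderiv_eq]

theorem gradSq_eigenCutoff {c R ε : ℝ} {x : ℝ × ℝ} (hx : x ∈ quarterDisk R) :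
    gradSq (eigenCutoff c R ε) x = (deriv smoothTransition (quarterEigenfunction c x / ε - 1) / ε) ^ 2 *
      gradSq (quarterEigenfunction c) x := by
  have h1 : eigenCutoff c R ε =ᶠ[nhds x]
      fun x => smoothTransition (quarterEigenfunction c x / ε - 1) := by
    filter_upwards [(isOpen_quarterDisk R).mem_nhds hx] with y hy
    exact indicator_of_mem hy _
  have hst : ContDiff ℝ 1 smoothTransition := smoothTransition.contDiff
  have h2 := gradSq_comp (f := fun s => smoothTransition (s / ε - 1)) (by fun_prop)
    ((contDiff_quarterEigenfunction c).of_le (by exact_mod_cast le_top)) x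
  rw [gradSq_congr_of_eventuallyEq h1, h2]
  congr 2
  have h3 : HasDerivAt (fun s : ℝ => s / ε - 1) (1 / ε) (quarterEigenfunction c x) :=
    ((hasDerivAt_id _).div_const ε).sub_const 1
  have h4 := ((hst.differentiable one_ne_zero _).hasDerivAt.comp _ h3).deriv
  rw [mul_one_div] at h4
  exact h4

theorem tendsto_integral_gradSq_eigenCutoff {c R s₀ : ℝ} (hc : 0 < c) (hR : 0 < R)
    (hcR : c * R ^ 2 = s₀) (h₀ : besselSeries 2 s₀ = 0)
    (hs₀ : ∀ s ∈ Ico 0 s₀, 0 < besselSeries 2 s) :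
    Filter.Tendsto (fun ε => ∫ x in quarterDisk R,
      quarterEigenfunction c x ^ 2 * gradSq (eigenCutoff c R ε) x) (nhdsWithin 0 (Ioi 0))
      (nhds 0) := by
  obtain ⟨M, hM0, hM⟩ := exists_abs_deriv_smoothTransition_le
  have hφ := (contDiff_quarterEigenfunction c).continuous
  have hφ1 : ContDiff ℝ 1 (quarterEigenfunction c) :=
    (contDiff_quarterEigenfunction c).of_le (by exact_mod_cast le_top)
  obtain ⟨B, hB⟩ := (isCompact_closedQuarterDisk hR).exists_bound_of_continuousOn
    (continuous_gradSq hφ1).continuousOn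
  have hfin : volume (quarterDisk R) ≠ ⊤ := ((measure_mono
    (quarterDisk_subset_closedQuarterDisk R)).trans_lt
      (isCompact_closedQuarterDisk hR).measure_lt_top).ne
  have hmeas := (isOpen_quarterDisk R).measurableSet
  have hpos : ∀ᶠ ε in nhdsWithin (0 : ℝ) (Ioi 0), 0 < ε := self_mem_nhdsWithin
  suffices h : Filter.Tendsto (fun ε => ∫ x in quarterDisk R,
      quarterEigenfunction c x ^ 2 * gradSq (eigenCutoff c R ε) x) (nhdsWithin 0 (Ioi 0))
      (nhds (∫ _ in quarterDisk R, (0 : ℝ))) by simpa using h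
  refine tendsto_integral_filter_of_dominated_convergence (fun _ => 4 * M ^ 2 * B) ?_ ?_ ?_ ?_
  · filter_upwards [hpos] with ε hε
    have h1 : Continuous (gradSq (eigenCutoff c R ε)) :=
      continuous_gradSq ((contDiff_eigenCutoff hR hcR h₀ hε).of_le (by exact_mod_cast le_top))
    exact Continuous.aestronglyMeasurable (by fun_prop)
  · filter_upwards [hpos] with ε hε
    refine ae_restrict_of_forall_mem hmeas fun x hx => ?_
    have hφx := quarterEigenfunction_pos hc hcR hs₀ hx
    have hBx := hB x (quarterDisk_subset_closedQuarterDisk R hx)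
    rw [Real.norm_of_nonneg (gradSq_nonneg _ _)] at hBx
    have hB0 : 0 ≤ B := (gradSq_nonneg _ _).trans hBx
    rw [Real.norm_of_nonneg (mul_nonneg (sq_nonneg _) (gradSq_nonneg _ _)),
      gradSq_eigenCutoff hx, ← mul_assoc, ← mul_pow]
    refine mul_le_mul ?_ hBx (gradSq_nonneg _ _) (by positivity)
    by_cases hs : quarterEigenfunction c x / ε - 1 < 0 ∨ 1 < quarterEigenfunction c x / ε - 1
    · rw [deriv_smoothTransition_eq_zero hs]
      simp only [zero_div, mul_zero, zero_pow two_ne_zero]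
      positivity
    · push Not at hs
      have h1 : |quarterEigenfunction c x / ε| ≤ 2 := by
        rw [abs_of_pos (by positivity)]
        linarith [hs.2]
      have h2 := hM (quarterEigenfunction c x / ε - 1)
      calc _ = (|quarterEigenfunction c x / ε| *
          |deriv smoothTransition (quarterEigenfunction c x / ε - 1)|) ^ 2 := by
            rw [← abs_mul, sq_abs]
            ring
        _ ≤ (2 * M) ^ 2 := by gcongr
        _ = 4 * M ^ 2 := by ring
  · have : IsFiniteMeasure (volume.restrict (quarterDisk R)) := ⟨by
      rw [Measure.restrict_apply_univ]
      exact hfin.lt_top⟩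
    exact integrable_const _
  · refine ae_restrict_of_forall_mem hmeas fun x hx => ?_
    have hφx := quarterEigenfunction_pos hc hcR hs₀ hx
    refine tendsto_const_nhds.congr' ?_
    have hlt : ∀ᶠ ε in nhdsWithin (0 : ℝ) (Ioi 0), ε < quarterEigenfunction c x / 2 :=
      nhdsWithin_le_nhds (Iio_mem_nhds (by positivity))
    filter_upwards [hpos, hlt] with ε hε hεx
    rw [gradSq_eigenCutoff hx, deriv_smoothTransition_eq_zero]
    · simp
    · right
      rw [lt_sub_iff_add_lt, lt_div_iff₀ hε]
      linarith

theorem integrableOn_quarterDisk {R : ℝ} (hR : 0 < R) {F : ℝ × ℝ → ℝ} (hF : Continuous F) :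
    IntegrableOn F (quarterDisk R) :=
  (hF.continuousOn.integrableOn_compact (isCompact_closedQuarterDisk hR)).mono_set
    (quarterDisk_subset_closedQuarterDisk R)

theorem eigenCutoff_sq_le_one (c R ε : ℝ) (x : ℝ × ℝ) : eigenCutoff c R ε x ^ 2 ≤ 1 := by
  by_cases hx : x ∈ quarterDisk R
  · rw [eigenCutoff, indicator_of_mem hx]
    exact pow_le_one₀ (smoothTransition.nonneg _) (smoothTransition.le_one _)
  · rw [eigenCutoff, indicator_of_notMem hx]
    norm_num

/-- Cutting the eigenfunction off away from the crack raises the eigenvalue at most by a multiple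
of the weighted energy of the cutoff function. -/
theorem exists_dirichletEV_le_of_cutoff {c R s₀ a b : ℝ} (hc : 0 < c) (hR : 0 < R)
    (hcR : c * R ^ 2 = s₀) (h₀ : besselSeries 2 s₀ = 0)
    (hs₀ : ∀ s ∈ Ico 0 s₀, 0 < besselSeries 2 s) (ha : 0 < a) (hab : a < b)
    (hbR : 2 * b ^ 2 < R ^ 2) :
    ∃ m : ℝ, 0 < m ∧ ∀ (ω : Set (ℝ × ℝ)) (χ : ℝ × ℝ → ℝ), (∀ x ∈ ω, (-x.1, x.2) ∈ ω) →
      ContDiff ℝ (⊤ : ℕ∞) χ → (∀ x, χ x ^ 2 ≤ 1) → (∀ x ∈ Icc a b ×ˢ Icc a b, χ x = 1) →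
      quarterDisk R ∩ tsupport χ ⊆ ω →
      (∃ V : Submodule ℝ ((ℝ × ℝ) → ℝ),
        (V : Set ((ℝ × ℝ) → ℝ)) ⊆ {u | testFun ω u} ∧ Module.finrank ℝ V = 2) ∧
      dirichletEV ω 2 ≤ 4 * c +
        m * ∫ x in quarterDisk R, quarterEigenfunction c x ^ 2 * gradSq χ x := by
  set φ := quarterEigenfunction c with hφ_def
  have hφs : ContDiff ℝ (⊤ : ℕ∞) φ := contDiff_quarterEigenfunction c
  have hφc : Continuous φ := hφs.continuous
  have hA : IsCompact (Icc a b ×ˢ Icc a b) := isCompact_Icc.prod isCompact_Icc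
  have hAQ : Icc a b ×ˢ Icc a b ⊆ quarterDisk R := by
    rintro x ⟨h1, h2⟩
    exact ⟨by nlinarith [h1.1, h1.2, h2.1, h2.2], ha.trans_le h1.1, ha.trans_le h2.1⟩
  obtain ⟨p, hp, hmin⟩ := hA.exists_isMinOn ⟨(a, a), ⟨le_rfl, hab.le⟩, ⟨le_rfl, hab.le⟩⟩
    hφc.continuousOn
  have hμ : 0 < φ p := quarterEigenfunction_pos hc hcR hs₀ (hAQ hp)
  set D := φ p ^ 2 * (b - a) ^ 2 with hD_def
  have hba : 0 < b - a := sub_pos.2 hab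
  have hD : 0 < D := by positivity
  refine ⟨2 / D, by positivity, fun ω χ hω hχ hχ1 hχA hχω => ?_⟩
  set E := ∫ x in quarterDisk R, φ x ^ 2 * gradSq χ x with hE_def
  have hE0 : 0 ≤ E := integral_nonneg fun x => mul_nonneg (sq_nonneg _) (gradSq_nonneg _ _)
  have hQm := (isOpen_quarterDisk R).measurableSet
  have key : ∀ ε, 0 < ε → ε < φ p / 2 → (∃ V : Submodule ℝ ((ℝ × ℝ) → ℝ),
        (V : Set ((ℝ × ℝ) → ℝ)) ⊆ {u | testFun ω u} ∧ Module.finrank ℝ V = 2) ∧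
      dirichletEV ω 2 ≤ 4 * c + (2 * (∫ x in quarterDisk R,
        φ x ^ 2 * gradSq (eigenCutoff c R ε) x) + 2 * E) / D := by
    intro ε hε hεp
    obtain ⟨hKc, hKQ, hKt⟩ := tsupport_eigenCutoff_subset hR hcR h₀ hε
    set X : ℝ × ℝ → ℝ := fun x => eigenCutoff c R ε x * χ x with hX_def
    have hecs := contDiff_eigenCutoff hR hcR h₀ hε
    have hec1 : ContDiff ℝ 1 (eigenCutoff c R ε) := hecs.of_le (by exact_mod_cast le_top)
    have hχ1' : ContDiff ℝ 1 χ := hχ.of_le (by exact_mod_cast le_top)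
    have hXs : ContDiff ℝ (⊤ : ℕ∞) X := hecs.mul hχ
    have hX1 : ContDiff ℝ 1 X := hec1.mul hχ1'
    have hXt : tsupport X ⊆ tsupport (eigenCutoff c R ε) := tsupport_mul_subset_left
    have hXt' : tsupport X ⊆ tsupport χ := tsupport_mul_subset_right
    have hXc : HasCompactSupport X := hKc.of_isClosed_subset (isClosed_tsupport X) (hXt.trans hKt)
    have hXQ : tsupport X ⊆ quarterDisk R := hXt.trans (hKt.trans hKQ)
    set ψ : ℝ × ℝ → ℝ := fun x => X x * φ x with hψ_def
    have hψt : tsupport ψ ⊆ tsupport X := tsupport_mul_subset_left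
    have hψ : testFun (ω ∩ {x | 0 < x.1}) ψ := by
      refine ⟨hXs.mul hφs, hXc.mul_right, fun x hx => ?_⟩
      have hxQ := hXQ (hψt hx)
      exact ⟨hχω ⟨hxQ, hXt' (hψt hx)⟩, hxQ.2.1⟩
    have hψA : ∀ x ∈ Icc a b ×ˢ Icc a b, φ p ≤ ψ x := by
      intro x hx
      have hpx : φ p ≤ φ x := hmin hx
      simp only [hψ_def, hX_def]
      rw [hχA x hx, eigenCutoff, indicator_of_mem (hAQ hx), smoothTransition.one_of_one_le]
      · linarith
      · rw [le_sub_iff_add_le, le_div_iff₀ hε]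
        change (1 + 1) * ε ≤ φ x
        linarith
    have hψ0 : ψ ≠ 0 := by
      intro h
      have := hψA p hp
      rw [h] at this
      exact absurd hμ (not_lt.2 this)
    have hψi := integrable_sq_of_hasCompactSupport hψ.1.continuous hψ.2.1
    have hDψ : D ≤ ∫ x, ψ x ^ 2 := by
      calc D = ∫ _ in Icc a b ×ˢ Icc a b, φ p ^ 2 := by
            rw [setIntegral_const, Measure.volume_eq_prod, measureReal_prod_prod,
              Real.volume_real_Icc_of_le hab.le, smul_eq_mul]
            ring
        _ ≤ ∫ x in Icc a b ×ˢ Icc a b, ψ x ^ 2 := by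
            refine setIntegral_mono_on (integrableOn_const hA.measure_lt_top.ne) hψi.integrableOn
              hA.measurableSet fun x hx => ?_
            have := hψA x hx
            gcongr
        _ ≤ ∫ x, ψ x ^ 2 := setIntegral_le_integral hψi
            (Filter.Eventually.of_forall fun _ => sq_nonneg _)
    obtain ⟨hV, hle⟩ := dirichletEV_two_le_of_reflection hω hψ hψ0
    refine ⟨hV, hle.trans ?_⟩
    have hgc := continuous_gradSq hec1
    have hgχ := continuous_gradSq hχ1'
    have hgX := continuous_gradSq hX1
    have hEX : ∫ x, φ x ^ 2 * gradSq X x ≤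
        2 * (∫ x in quarterDisk R, φ x ^ 2 * gradSq (eigenCutoff c R ε) x) + 2 * E := by
      rw [← setIntegral_eq_integral_of_forall_compl_eq_zero (s := quarterDisk R) fun x hx => by
        rw [gradSq_eq_zero_of_notMem_tsupport fun h => hx (hXQ h), mul_zero], hE_def,
        ← integral_const_mul, ← integral_const_mul, ← integral_add
        ((integrableOn_quarterDisk hR (by fun_prop)).const_mul 2)
        ((integrableOn_quarterDisk hR (by fun_prop)).const_mul 2)]
      refine setIntegral_mono_on (integrableOn_quarterDisk hR (by fun_prop))
        (integrableOn_quarterDisk hR (by fun_prop)) hQm fun x _ => ?_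
      have h1 := gradSq_mul_le hec1 hχ1' (eigenCutoff_sq_le_one c R ε) x
      have h2 := mul_le_mul_of_nonneg_right (hχ1 x) (gradSq_nonneg (eigenCutoff c R ε) x)
      have h3 : gradSq X x ≤ 2 * gradSq (eigenCutoff c R ε) x + 2 * gradSq χ x := by
        simp only [hX_def]
        linarith
      have h4 := mul_le_mul_of_nonneg_left h3 (sq_nonneg (φ x))
      linarith
    have hloc := integral_gradSq_mul_quarterEigenfunction c hX1 hXc
    change ∫ x, gradSq ψ x = 4 * c * (∫ x, ψ x ^ 2) + ∫ x, φ x ^ 2 * gradSq X x at hloc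
    have hψpos : 0 < ∫ x, ψ x ^ 2 := hD.trans_le hDψ
    rw [hloc, add_div, mul_div_cancel_right₀ _ hψpos.ne']
    have hnn : 0 ≤ ∫ x in quarterDisk R, φ x ^ 2 * gradSq (eigenCutoff c R ε) x :=
      integral_nonneg fun x => mul_nonneg (sq_nonneg _) (gradSq_nonneg _ _)
    gcongr
  refine ⟨(key (φ p / 4) (by positivity) (by linarith)).1, ?_⟩
  have hlim := ((((tendsto_integral_gradSq_eigenCutoff hc hR hcR h₀ hs₀).const_mul 2).add_const
    (2 * E)).div_const D).const_add (4 * c)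
  have hle := ge_of_tendsto (b := dirichletEV ω 2) hlim (by
    have h1 : ∀ᶠ ε in nhdsWithin (0 : ℝ) (Ioi 0), 0 < ε := self_mem_nhdsWithin
    have h2 : ∀ᶠ ε in nhdsWithin (0 : ℝ) (Ioi 0), ε < φ p / 2 :=
      nhdsWithin_le_nhds (Iio_mem_nhds (by positivity))
    filter_upwards [h1, h2] with ε hε hεp using (key ε hε hεp).2)
  refine hle.trans_eq ?_
  ring

theorem crackSetPlus_reflection {R₁ δ : ℝ} {x : ℝ × ℝ} (hR₁ : 0 < R₁) (hδ : δ < π / 2)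
    (hx : x ∈ crackSetPlus R₁ δ) : (-x.1, x.2) ∈ crackSetPlus R₁ δ ∧
      x.1 ^ 2 + (x.2 - R₁) ^ 2 ≤ (R₁ * δ) ^ 2 ∧ x.1 ^ 2 + x.2 ^ 2 = R₁ ^ 2 := by
  obtain ⟨⟨θ, hθ, rfl⟩, hpos⟩ := hx
  have hpos' : 0 < R₁ * Real.sin θ := hpos
  have hsin : 0 < Real.sin θ := (mul_pos_iff_of_pos_left hR₁).1 hpos'
  rcases hθ with hθ | hθ
  · refine ⟨⟨⟨π - θ, Or.inl ⟨by linarith [hθ.2], by linarith [hθ.1]⟩, ?_⟩, hpos⟩, ?_, ?_⟩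
    · rw [Real.cos_pi_sub, Real.sin_pi_sub, mul_neg]
    · have h1 := Real.one_sub_sq_div_two_le_cos (x := θ - π / 2)
      rw [Real.cos_sub_pi_div_two] at h1
      have h2 : (θ - π / 2) ^ 2 ≤ δ ^ 2 :=
        sq_le_sq' (by linarith [hθ.1]) (by linarith [hθ.2])
      have h3 := Real.sin_sq_add_cos_sq θ
      calc (R₁ * Real.cos θ) ^ 2 + (R₁ * Real.sin θ - R₁) ^ 2
          = R₁ ^ 2 * (2 - 2 * Real.sin θ) := by linear_combination R₁ ^ 2 * h3
        _ ≤ R₁ ^ 2 * δ ^ 2 := by gcongr; linarith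
        _ = (R₁ * δ) ^ 2 := by ring
    · linear_combination R₁ ^ 2 * Real.sin_sq_add_cos_sq θ
  · exact absurd hsin (Real.sin_neg_of_neg_of_neg_pi_lt (by linarith [hθ.2])
      (by linarith [hθ.1])).not_gt

theorem crackedHalfDisk_reflection {R₁ R₂ δ : ℝ} (hR₁ : 0 < R₁) (hδ : δ < π / 2) {x : ℝ × ℝ}
    (hx : x ∈ halfDisk R₂ \ crackSetPlus R₁ δ) :
    (-x.1, x.2) ∈ halfDisk R₂ \ crackSetPlus R₁ δ := by
  obtain ⟨⟨h1, h2⟩, h3⟩ := hx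
  refine ⟨⟨?_, h2⟩, fun h => h3 ?_⟩
  · simpa [disk] using h1
  · simpa using (crackSetPlus_reflection hR₁ hδ h).1

theorem contDiff_sq_dist (q : ℝ) :
    ContDiff ℝ (⊤ : ℕ∞) fun x : ℝ × ℝ => x.1 ^ 2 + (x.2 - q) ^ 2 := by
  fun_prop

theorem gradSq_sq_dist (q : ℝ) (x : ℝ × ℝ) :
    gradSq (fun x => x.1 ^ 2 + (x.2 - q) ^ 2) x = 4 * (x.1 ^ 2 + (x.2 - q) ^ 2) := by
  have h := (((hasFDerivAt_fst (𝕜 := ℝ) (p := x)).pow 2).add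
    (((hasFDerivAt_snd (𝕜 := ℝ) (p := x)).sub_const q).pow 2)).fderiv
  change fderiv ℝ (fun x : ℝ × ℝ => x.1 ^ 2 + (x.2 - q) ^ 2) x = _ at h
  unfold gradSq
  rw [h]
  simp
  ring

/-- A cutoff function vanishing near the point `(0, q)`, at scale `r`. -/
def pointCutoff (q r : ℝ) (x : ℝ × ℝ) : ℝ :=
  smoothTransition ((x.1 ^ 2 + (x.2 - q) ^ 2) / r ^ 2 - 2)

theorem contDiff_pointCutoff (q r : ℝ) : ContDiff ℝ (⊤ : ℕ∞) (pointCutoff q r) :=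
  smoothTransition.contDiff.comp (by fun_prop : ContDiff ℝ (⊤ : ℕ∞)
    fun x : ℝ × ℝ => (x.1 ^ 2 + (x.2 - q) ^ 2) / r ^ 2 - 2)

theorem gradSq_pointCutoff (q r : ℝ) (x : ℝ × ℝ) :
    gradSq (pointCutoff q r) x =
      (deriv smoothTransition ((x.1 ^ 2 + (x.2 - q) ^ 2) / r ^ 2 - 2) / r ^ 2) ^ 2 *
        (4 * (x.1 ^ 2 + (x.2 - q) ^ 2)) := by
  have hst : ContDiff ℝ 1 smoothTransition := smoothTransition.contDiff
  have h2 := gradSq_comp (f := fun s => smoothTransition (s / r ^ 2 - 2)) (by fun_prop)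
    ((contDiff_sq_dist q).of_le (by exact_mod_cast le_top)) x
  rw [gradSq_sq_dist] at h2
  refine h2.trans ?_
  congr 2
  have h3 : HasDerivAt (fun s : ℝ => s / r ^ 2 - 2) (1 / r ^ 2) (x.1 ^ 2 + (x.2 - q) ^ 2) :=
    ((hasDerivAt_id _).div_const (r ^ 2)).sub_const 2
  have h4 := ((hst.differentiable one_ne_zero _).hasDerivAt.comp _ h3).deriv
  rw [mul_one_div] at h4
  exact h4

theorem exists_quarterEigenfunction_sq_le (c : ℝ) {R : ℝ} (hR : 0 < R) :
    ∃ B : ℝ, ∀ x ∈ quarterDisk R, quarterEigenfunction c x ^ 2 ≤ B ^ 2 * x.1 ^ 2 := by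
  have hb := continuous_besselSeries 2
  obtain ⟨B, hB⟩ := (isCompact_closedQuarterDisk hR).exists_bound_of_continuousOn
    (f := fun x : ℝ × ℝ => x.2 * besselSeries 2 (c * (x.1 ^ 2 + x.2 ^ 2)))
    (Continuous.continuousOn (by fun_prop))
  refine ⟨B, fun x hx => ?_⟩
  have h := hB x (quarterDisk_subset_closedQuarterDisk R hx)
  rw [Real.norm_eq_abs] at h
  calc quarterEigenfunction c x ^ 2
      = |x.2 * besselSeries 2 (c * (x.1 ^ 2 + x.2 ^ 2))| ^ 2 * x.1 ^ 2 := by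
        rw [sq_abs, quarterEigenfunction]
        ring
    _ ≤ B ^ 2 * x.1 ^ 2 := by gcongr

theorem exists_pointCutoff_energy_le (c : ℝ) {R : ℝ} (hR : 0 < R) :
    ∃ N : ℝ, 0 ≤ N ∧ ∀ q r : ℝ, 0 < r →
      ∫ x in quarterDisk R, quarterEigenfunction c x ^ 2 * gradSq (pointCutoff q r) x ≤
        N * r ^ 2 := by
  obtain ⟨M, hM0, hM⟩ := exists_abs_deriv_smoothTransition_le
  obtain ⟨B, hB⟩ := exists_quarterEigenfunction_sq_le c hR
  refine ⟨B ^ 2 * M ^ 2 * 36 * 16, by positivity, fun q r hr => ?_⟩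
  set F : ℝ × ℝ → ℝ := fun x => quarterEigenfunction c x ^ 2 * gradSq (pointCutoff q r) x
  set S : Set (ℝ × ℝ) := Icc (-(2 * r)) (2 * r) ×ˢ Icc (q - 2 * r) (q + 2 * r) with hS
  have hfar : ∀ x : ℝ × ℝ, 3 * r ^ 2 < x.1 ^ 2 + (x.2 - q) ^ 2 → F x = 0 := by
    intro x hx
    simp only [F]
    rw [gradSq_pointCutoff, deriv_smoothTransition_eq_zero]
    · ring
    · right
      rw [lt_sub_iff_add_lt, lt_div_iff₀ (by positivity)]
      linarith
  have hSF : ∀ x, x ∉ S → F x = 0 := by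
    intro x hx
    refine hfar x (lt_of_not_ge fun h => hx ⟨⟨?_, ?_⟩, ?_, ?_⟩)
    · nlinarith [sq_nonneg (x.2 - q)]
    · nlinarith [sq_nonneg (x.2 - q)]
    · nlinarith [sq_nonneg x.1]
    · nlinarith [sq_nonneg x.1]
  have hSm : MeasurableSet S := measurableSet_Icc.prod measurableSet_Icc
  have hSc : IsCompact S := isCompact_Icc.prod isCompact_Icc
  have hQm := (isOpen_quarterDisk R).measurableSet
  have hvol : volume.real (quarterDisk R ∩ S) ≤ 16 * r ^ 2 := by
    refine (measureReal_mono inter_subset_right hSc.measure_lt_top.ne).trans_eq ?_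
    rw [hS, Measure.volume_eq_prod, measureReal_prod_prod,
      Real.volume_real_Icc_of_le (by linarith), Real.volume_real_Icc_of_le (by linarith)]
    ring
  have hbd : ∀ x ∈ quarterDisk R ∩ S, ‖F x‖ ≤ B ^ 2 * M ^ 2 * 36 := by
    rintro x ⟨hx, -⟩
    rw [Real.norm_of_nonneg (mul_nonneg (sq_nonneg _) (gradSq_nonneg _ _))]
    rcases lt_or_ge (3 * r ^ 2) (x.1 ^ 2 + (x.2 - q) ^ 2) with h | h
    · rw [show quarterEigenfunction c x ^ 2 * gradSq (pointCutoff q r) x = 0 from hfar x h]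
      positivity
    · have h1 : gradSq (pointCutoff q r) x ≤ (M / r ^ 2) ^ 2 * (4 * (3 * r ^ 2)) := by
        rw [gradSq_pointCutoff, ← sq_abs (_ / _), abs_div, abs_of_pos (by positivity : 0 < r ^ 2)]
        gcongr
        exact hM _
      have h2 : quarterEigenfunction c x ^ 2 ≤ B ^ 2 * (3 * r ^ 2) :=
        (hB x hx).trans (by gcongr; nlinarith [sq_nonneg (x.2 - q)])
      calc F x ≤ B ^ 2 * (3 * r ^ 2) * ((M / r ^ 2) ^ 2 * (4 * (3 * r ^ 2))) :=
            mul_le_mul h2 h1 (gradSq_nonneg _ _) (by positivity)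
        _ = B ^ 2 * M ^ 2 * 36 := by field_simp; ring
  have hfin : volume (quarterDisk R ∩ S) < ⊤ :=
    (measure_mono inter_subset_right).trans_lt hSc.measure_lt_top
  calc ∫ x in quarterDisk R, F x = ∫ x in quarterDisk R ∩ S, F x :=
        setIntegral_eq_of_subset_of_forall_sdiff_eq_zero hQm inter_subset_left
          fun x hx => hSF x fun h => hx.2 ⟨hx.1, h⟩
    _ ≤ ‖∫ x in quarterDisk R ∩ S, F x‖ := Real.le_norm_self _
    _ ≤ B ^ 2 * M ^ 2 * 36 * volume.real (quarterDisk R ∩ S) :=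
        norm_setIntegral_le_of_norm_le_const hfin hbd
    _ ≤ B ^ 2 * M ^ 2 * 36 * (16 * r ^ 2) := by gcongr
    _ = _ := by ring

/-- A cutoff function supported inside the circle of radius `R₁`. -/
def innerCutoff (R₁ : ℝ) (x : ℝ × ℝ) : ℝ :=
  smoothTransition (3 - 4 * (x.1 ^ 2 + x.2 ^ 2) / R₁ ^ 2)

theorem contDiff_innerCutoff (R₁ : ℝ) : ContDiff ℝ (⊤ : ℕ∞) (innerCutoff R₁) :=
  smoothTransition.contDiff.comp (by fun_prop : ContDiff ℝ (⊤ : ℕ∞)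
    fun x : ℝ × ℝ => 3 - 4 * (x.1 ^ 2 + x.2 ^ 2) / R₁ ^ 2)

theorem smoothTransition_sq_le_one (s : ℝ) : smoothTransition s ^ 2 ≤ 1 :=
  pow_le_one₀ (smoothTransition.nonneg _) (smoothTransition.le_one _)

theorem two_mul_le_of_mem_tsupport_pointCutoff {q r : ℝ} (hr : 0 < r) {x : ℝ × ℝ}
    (hx : x ∈ tsupport (pointCutoff q r)) : 2 * r ^ 2 ≤ x.1 ^ 2 + (x.2 - q) ^ 2 := by
  refine closure_minimal (t := {x : ℝ × ℝ | 2 * r ^ 2 ≤ x.1 ^ 2 + (x.2 - q) ^ 2}) ?_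
    (isClosed_le continuous_const (by fun_prop)) hx
  intro y hy
  by_contra h
  rw [mem_ofPred_eq, not_le] at h
  refine hy (smoothTransition.zero_of_nonpos ?_)
  rw [sub_nonpos, div_le_iff₀ (by positivity)]
  exact h.le

theorem le_of_mem_tsupport_innerCutoff {R₁ : ℝ} (hR₁ : 0 < R₁) {x : ℝ × ℝ}
    (hx : x ∈ tsupport (innerCutoff R₁)) : 4 * (x.1 ^ 2 + x.2 ^ 2) ≤ 3 * R₁ ^ 2 := by
  refine closure_minimal (t := {x : ℝ × ℝ | 4 * (x.1 ^ 2 + x.2 ^ 2) ≤ 3 * R₁ ^ 2}) ?_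
    (isClosed_le (by fun_prop) continuous_const) hx
  intro y hy
  by_contra h
  rw [mem_ofPred_eq, not_le] at h
  refine hy (smoothTransition.zero_of_nonpos ?_)
  rw [sub_nonpos, le_div_iff₀ (by positivity)]
  exact h.le

theorem quarterDisk_subset_halfDisk (R : ℝ) : quarterDisk R ⊆ halfDisk R :=
  fun _ h => ⟨h.1, h.2.2⟩

/-- the DDD case: `λ₂(B_{R₂}⁺) ≤ λ₂(B_{R₂}⁺ \ K_δ⁺) ≤ λ₂(B_{R₂}⁺) + Cδ²`. -/
theorem DDD_eigenvalue_bounds (R₁ R₂ : ℝ) (hR₁ : 0 < R₁) (hR₁₂ : R₁ < R₂) :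
    ∃ C : ℝ, 0 < C ∧ ∀ δ ∈ Set.Ioo (0 : ℝ) (π / 2),
      dirichletEV (halfDisk R₂) 2 ≤ dirichletEV (halfDisk R₂ \ crackSetPlus R₁ δ) 2 ∧
      dirichletEV (halfDisk R₂ \ crackSetPlus R₁ δ) 2 ≤ dirichletEV (halfDisk R₂) 2 + C * δ ^ 2 := by
  obtain ⟨s₀, hs₀, h₀, hpos⟩ := exists_first_zero_besselSeries_two
  have hR : 0 < R₂ := hR₁.trans hR₁₂
  set c := s₀ / R₂ ^ 2 with hc_def
  have hc : 0 < c := by positivity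
  have hcR : c * R₂ ^ 2 = s₀ := by rw [hc_def]; field_simp
  obtain ⟨m, hm, hbound⟩ := exists_dirichletEV_le_of_cutoff (a := R₁ / 8) (b := R₁ / 4) hc hR hcR
    h₀ hpos (by positivity) (by linarith) (by nlinarith)
  obtain ⟨N, hN, henergy⟩ := exists_pointCutoff_energy_le c hR
  set E := ∫ x in quarterDisk R₂, quarterEigenfunction c x ^ 2 * gradSq (innerCutoff R₁) x
  have hE : 0 ≤ E := integral_nonneg fun x => mul_nonneg (sq_nonneg _) (gradSq_nonneg _ _)
  refine ⟨m * (N * R₁ ^ 2 + 8 * E) + 1, by positivity, fun δ hδ => ?_⟩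
  set ω := halfDisk R₂ \ crackSetPlus R₁ δ with hω
  have hδ0 : 0 < δ := hδ.1
  have hsym : ∀ x ∈ ω, (-x.1, x.2) ∈ ω := fun x hx => crackedHalfDisk_reflection hR₁ hδ.2 hx
  have hmain : (∃ V : Submodule ℝ ((ℝ × ℝ) → ℝ),
        (V : Set ((ℝ × ℝ) → ℝ)) ⊆ {u | testFun ω u} ∧ Module.finrank ℝ V = 2) ∧
      dirichletEV ω 2 ≤ 4 * c + m * ((N * R₁ ^ 2 + 8 * E) * δ ^ 2) := by
    rcases le_or_gt (δ ^ 2) (1 / 8) with hsmall | hlarge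
    · have hr : 0 < R₁ * δ := by positivity
      have hone : ∀ x ∈ Icc (R₁ / 8) (R₁ / 4) ×ˢ Icc (R₁ / 8) (R₁ / 4),
          pointCutoff R₁ (R₁ * δ) x = 1 := by
        rintro x ⟨-, h2⟩
        refine smoothTransition.one_of_one_le ?_
        rw [le_sub_iff_add_le, le_div_iff₀ (by positivity)]
        nlinarith [h2.2, sq_nonneg x.1, mul_le_mul_of_nonneg_left hsmall (sq_nonneg R₁)]
      have hsupp : quarterDisk R₂ ∩ tsupport (pointCutoff R₁ (R₁ * δ)) ⊆ ω := by
        rintro x ⟨hx, hxt⟩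
        refine ⟨quarterDisk_subset_halfDisk R₂ hx, fun hxK => ?_⟩
        have h1 := two_mul_le_of_mem_tsupport_pointCutoff hr hxt
        have h2 := (crackSetPlus_reflection hR₁ hδ.2 hxK).2.1
        nlinarith
      obtain ⟨hne, hle⟩ := hbound ω (pointCutoff R₁ (R₁ * δ)) hsym (contDiff_pointCutoff _ _)
        (fun x => smoothTransition_sq_le_one _) hone hsupp
      refine ⟨hne, hle.trans ?_⟩
      gcongr
      refine (henergy R₁ (R₁ * δ) hr).trans ?_
      nlinarith [mul_nonneg hE (sq_nonneg δ)]
    · have hone : ∀ x ∈ Icc (R₁ / 8) (R₁ / 4) ×ˢ Icc (R₁ / 8) (R₁ / 4),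
          innerCutoff R₁ x = 1 := by
        rintro x ⟨h1, h2⟩
        refine smoothTransition.one_of_one_le ?_
        rw [le_sub_comm, div_le_iff₀ (by positivity)]
        nlinarith [h1.1, h1.2, h2.1, h2.2]
      have hsupp : quarterDisk R₂ ∩ tsupport (innerCutoff R₁) ⊆ ω := by
        rintro x ⟨hx, hxt⟩
        refine ⟨quarterDisk_subset_halfDisk R₂ hx, fun hxK => ?_⟩
        have h1 := le_of_mem_tsupport_innerCutoff hR₁ hxt
        have h2 := (crackSetPlus_reflection hR₁ hδ.2 hxK).2.2
        nlinarith
      obtain ⟨hne, hle⟩ := hbound ω (innerCutoff R₁) hsym (contDiff_innerCutoff _)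
        (fun x => smoothTransition_sq_le_one _) hone hsupp
      refine ⟨hne, hle.trans ?_⟩
      gcongr
      change E ≤ _
      have h1 : 0 ≤ N * R₁ ^ 2 * δ ^ 2 := by positivity
      nlinarith
  obtain ⟨hne, hle⟩ := hmain
  refine ⟨dirichletEV_anti sdiff_subset hne, hle.trans ?_⟩
  have hne' : ∃ V : Submodule ℝ ((ℝ × ℝ) → ℝ),
      (V : Set ((ℝ × ℝ) → ℝ)) ⊆ {u | testFun (halfDisk R₂) u} ∧ Module.finrank ℝ V = 2 := by
    obtain ⟨V, hV, hk⟩ := hne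
    exact ⟨V, fun u hu => ⟨(hV hu).1, (hV hu).2.1, (hV hu).2.2.trans sdiff_subset⟩, hk⟩
  have h := le_dirichletEV_halfDisk hc hR hcR hpos hne'
  nlinarith [sq_nonneg δ]
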